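/- arXiv:2505.09909 — 6 statements merged into one kernel-verified Lean document; each statement's English description precedes it below -/
import Mathlib

section
/- Let D be a division ring whose center contains at least three elements, and let n be a positive integer. Then every n×n matrix over D can be written as a sum of two diagonalizable matrices over D. -/
/-- `M` is diagonalizable over `D`: similar over `D` to a diagonal matrix. -/
def IsDiagonalizable {D : Type*} [DivisionRing D] {ι : Type*} [Fintype ι] [DecidableEq ι]
    (M : Matrix ι ι D) : Prop :=
  ∃ P Q : Matrix ι ι D, P * Q = 1 ∧ Q * P = 1 ∧ ∃ d : ι → D, Q * M * P = Matrix.diagonal d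

open Module

section Diagonalization

variable {D V : Type*} [DivisionRing D] [AddCommGroup V] [Module D V]

/-- The span of the eigenvectors of `f` whose eigenvalue lies in `S`. -/
def eigenspan (f : Module.End D V) (S : Set D) : Submodule D V :=
  Submodule.span D {v | ∃ d ∈ S, f v = d • v}

theorem eigenspan_mono (f : Module.End D V) {S T : Set D} (h : S ⊆ T) :
    eigenspan f S ≤ eigenspan f T :=
  Submodule.span_mono fun _ ⟨d, hd, hv⟩ => ⟨d, h hd, hv⟩

theorem mem_eigenspan {f : Module.End D V} {S : Set D} {d : D} (hd : d ∈ S) {v : V}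
    (hv : f v = d • v) : v ∈ eigenspan f S :=
  Submodule.subset_span ⟨d, hd, hv⟩

/-- The equation `q • u - f u = w` is solvable in the span of the eigenvectors with central
eigenvalues different from `q`. -/
theorem exists_apply_add_eq_smul {f : Module.End D V} {S : Set D}
    (hS : S ⊆ Set.center D) {q : D} (hq : q ∉ S) {w : V} (hw : w ∈ eigenspan f S) :
    ∃ u ∈ eigenspan f S, f u + w = q • u := by
  induction hw using Submodule.closure_induction with
  | zero => exact ⟨0, zero_mem _, by simp⟩
  | add x y _ _ hx hy =>
    obtain ⟨u, hu, hux⟩ := hx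
    obtain ⟨v, hv, hvy⟩ := hy
    refine ⟨u + v, add_mem hu hv, ?_⟩
    rw [map_add, smul_add, ← hux, ← hvy]
    abel
  | smul_mem r x h =>
    obtain ⟨d, hd, hx⟩ := h
    have hqd : q - d ≠ 0 := sub_ne_zero.2 fun e => hq (e ▸ hd)
    have hcomm : ∀ a, a * d = d * a := fun a => ((hS hd).comm a).symm
    refine ⟨((q - d)⁻¹ * r) • x, Submodule.smul_mem _ _ (mem_eigenspan hd hx), ?_⟩
    rw [map_smul, hx, smul_smul, smul_smul, ← add_smul, hcomm, ← sub_eq_iff_eq_add'.1]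
    rw [← sub_mul, ← mul_assoc, mul_inv_cancel₀ hqd, one_mul]

theorem mem_eigenspan_of_apply_eq {f : Module.End D V} {S T : Set D}
    (hS : S ⊆ Set.center D) (hST : S ⊆ T) {q : D} (hq : q ∉ S) (hqT : q ∈ T) {e w : V}
    (hw : w ∈ eigenspan f S) (he : f e = q • e + w) : e ∈ eigenspan f T := by
  obtain ⟨u, hu, h⟩ := exists_apply_add_eq_smul hS hq hw
  have : e + u ∈ eigenspan f T := mem_eigenspan hqT <| by
    rw [map_add, he, smul_add, ← h]; abel
  simpa using sub_mem this (eigenspan_mono f hST hu)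

end Diagonalization

theorem isDiagonalizable_of_eigenspan {D : Type*} [DivisionRing D] {n : ℕ}
    (M : Matrix (Fin n) (Fin n) D) (h : eigenspan M.vecMulLinear Set.univ = ⊤) :
    IsDiagonalizable M := by
  let b₀ := Basis.ofSpan h.ge
  let b := b₀.reindex (b₀.indexEquiv (Pi.basisFun D (Fin n)))
  have hb : ∀ i, ∃ d : D, Matrix.vecMul (b i) M = d • b i := by
    intro i
    have : b i ∈ {v | ∃ d ∈ (Set.univ : Set D), M.vecMulLinear v = d • v} := by
      rw [Basis.reindex_apply]
      exact Basis.ofSpan_subset h.ge ⟨_, rfl⟩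
    obtain ⟨d, -, hd⟩ := this
    exact ⟨d, hd⟩
  choose d hd using hb
  let Q : Matrix (Fin n) (Fin n) D := Matrix.of fun i => b i
  let P : Matrix (Fin n) (Fin n) D := Matrix.of fun i => b.repr (Pi.single i 1)
  have hPQ : P * Q = 1 := by
    ext i j
    have := congrFun (b.sum_repr (Pi.single i 1)) j
    simpa [Matrix.mul_apply, P, Q, Matrix.one_apply, Pi.single_apply, eq_comm] using this
  have hQP : Q * P = 1 := mul_eq_one_comm.1 hPQ
  refine ⟨P, Q, hPQ, hQP, d, ?_⟩
  have hQM : Q * M = Matrix.diagonal d * Q := by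
    ext i j
    rw [Matrix.diagonal_mul]
    exact congrFun (hd i) j
  rw [hQM, mul_assoc, hQP, mul_one]

/-- A central choice of the last two diagonal entries `g`, `p` of the first summand of a companion
matrix whose last diagonal entry is `c`. -/
theorem exists_diagonal_choice {D : Type*} [DivisionRing D] {β γ : D}
    (hβ : β ∈ Set.center D) (hγ : γ ∈ Set.center D) (hne : β ≠ γ)
    (h3 : ∀ x ∈ Set.center D, ∀ y ∈ Set.center D, ∃ z ∈ Set.center D, z ≠ x ∧ z ≠ y) (c : D) :
    ∃ g ∈ ({β, γ} : Set D), ∃ g' ∈ ({β, γ} : Set D), ∃ p ∈ Set.center D,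
      g' ≠ g ∧ p ≠ g ∧ c - p ∉ ({-β, -γ} : Set D) := by
  simp only [Set.mem_insert_iff, Set.mem_singleton_iff, not_or]
  by_cases hc : c = β - γ
  · obtain ⟨p, hp, h1, h2⟩ := h3 β hβ (c + β)
      (Set.add_mem_center (by rw [hc, sub_eq_add_neg]
                              exact Set.add_mem_center hβ (Set.neg_mem_center hγ)) hβ)
    refine ⟨β, by simp, γ, by simp, p, hp, hne.symm, h1, ?_, ?_⟩
    · intro h; apply h2; rw [sub_eq_iff_eq_add] at h; rw [h]; abel
    · intro h; apply h1; rw [sub_eq_iff_eq_add, hc] at h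
      rw [sub_eq_add_neg, add_comm] at h
      exact (add_left_cancel h).symm
  · by_cases h0 : c = 0
    · obtain ⟨p, hp, h1, h2⟩ := h3 β hβ γ hγ
      refine ⟨γ, by simp, β, by simp, p, hp, hne, h2, ?_, ?_⟩ <;> simpa [h0]
    · refine ⟨γ, by simp, β, by simp, β, hβ, hne, hne, ?_, ?_⟩
      · intro h; apply h0; rw [sub_eq_iff_eq_add] at h; rw [h]; abel
      · intro h; apply hc; rw [sub_eq_iff_eq_add] at h; rw [h]; abel

section Chains

variable {D V : Type*} [DivisionRing D] [AddCommGroup V] [Module D V]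

/-- The span of `v, f v, …, f ^ (m - 1) v`. -/
def chainSpan (f : Module.End D V) (v : V) (m : ℕ) : Submodule D V :=
  Submodule.span D ((fun i => (f ^ i) v) '' Set.Iio m)

theorem pow_apply_mem_chainSpan (f : Module.End D V) (v : V) {i m : ℕ} (h : i < m) :
    (f ^ i) v ∈ chainSpan f v m :=
  Submodule.subset_span ⟨i, h, rfl⟩

theorem chainSpan_mono (f : Module.End D V) (v : V) : Monotone (chainSpan f v) :=
  fun _ _ h => Submodule.span_mono (Set.image_mono (Set.Iio_subset_Iio h))

theorem exists_smul_add_of_mem_chainSpan_succ {f : Module.End D V} {v x : V} {m : ℕ}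
    (hx : x ∈ chainSpan f v (m + 1)) :
    ∃ a : D, ∃ y ∈ chainSpan f v m, x = a • (f ^ m) v + y := by
  rw [chainSpan, ← Order.succ_eq_add_one, Order.Iio_succ_eq_insert, Set.image_insert_eq,
    Submodule.mem_span_insert] at hx
  exact hx

theorem chainSpan_le_comap {f : Module.End D V} {v : V} {m : ℕ}
    (h : (f ^ m) v ∈ chainSpan f v m) : chainSpan f v m ≤ (chainSpan f v m).comap f := by
  refine Submodule.span_le.2 ?_
  rintro _ ⟨i, hi, rfl⟩
  change f ((f ^ i) v) ∈ chainSpan f v m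
  rw [← Module.End.mul_apply, ← pow_succ']
  rcases (Nat.succ_le_of_lt (Set.mem_Iio.1 hi)).lt_or_eq with h' | h'
  · exact pow_apply_mem_chainSpan f v h'
  · have h'' : i + 1 = m := h'
    rwa [h'']

theorem pow_apply_mem_chainSpan_of_le {f : Module.End D V} {v : V} {m m' : ℕ} (hm : m ≤ m')
    (h : (f ^ m) v ∈ chainSpan f v m) : (f ^ m') v ∈ chainSpan f v m' := by
  induction m', hm using Nat.le_induction with
  | base => exact h
  | succ k _ ih =>
    rw [pow_succ', Module.End.mul_apply]
    exact chainSpan_mono f v k.le_succ (chainSpan_le_comap ih ih)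

theorem range_chain (f : Module.End D V) (v : V) (m : ℕ) :
    Set.range (fun i : Fin m => (f ^ (i : ℕ)) v) = (fun i => (f ^ i) v) '' Set.Iio m := by
  rw [← Fin.range_val, ← Set.range_comp]
  rfl

theorem linearIndependent_chain_succ {f : Module.End D V} {v : V} {m : ℕ} :
    LinearIndependent D (fun i : Fin (m + 1) => (f ^ (i : ℕ)) v) ↔
      LinearIndependent D (fun i : Fin m => (f ^ (i : ℕ)) v) ∧ (f ^ m) v ∉ chainSpan f v m := by
  rw [linearIndependent_finSucc', chainSpan, ← range_chain]
  rfl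

theorem linearIndependent_chain {f : Module.End D V} {v : V} {m : ℕ}
    (h : (f ^ m) v ∉ chainSpan f v m) :
    LinearIndependent D (fun i : Fin (m + 1) => (f ^ (i : ℕ)) v) := by
  induction m with
  | zero => exact linearIndependent_chain_succ.2 ⟨linearIndependent_empty_type, h⟩
  | succ m ih =>
    exact linearIndependent_chain_succ.2
      ⟨ih fun h' => h (pow_apply_mem_chainSpan_of_le m.le_succ h'), h⟩

theorem le_of_linearIndependent_chain {f : Module.End D V} {v : V} {m N : ℕ}
    (hli : LinearIndependent D (fun i : Fin m => (f ^ (i : ℕ)) v))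
    (h : (f ^ N) v ∈ chainSpan f v N) : m ≤ N := by
  cases m with
  | zero => exact N.zero_le
  | succ m =>
    by_contra! hN
    exact (linearIndependent_chain_succ.1 hli).2
      (pow_apply_mem_chainSpan_of_le (Nat.le_of_lt_succ hN) h)

theorem pow_finrank_apply_mem_chainSpan [FiniteDimensional D V] (f : Module.End D V) (v : V) :
    (f ^ finrank D V) v ∈ chainSpan f v (finrank D V) := by
  by_contra h
  have := (linearIndependent_chain h).fintype_card_le_finrank
  simp at this

/-- There is a longest chain `v, f v, …, f ^ N v`. -/
theorem exists_longest_chain [FiniteDimensional D V] [Nontrivial V] (f : Module.End D V) :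
    ∃ N v, (f ^ N) v ∉ chainSpan f v N ∧ ∀ x, (f ^ (N + 1)) x ∈ chainSpan f x (N + 1) := by
  classical
  have hex : ∃ N, ∀ x, (f ^ N) x ∈ chainSpan f x N :=
    ⟨_, pow_finrank_apply_mem_chainSpan f⟩
  have hpos : Nat.find hex ≠ 0 := by
    intro h0
    obtain ⟨x, hx⟩ := exists_ne (0 : V)
    have := Nat.find_spec hex x
    rw [h0] at this
    simp [chainSpan, hx] at this
  obtain ⟨N, hN⟩ := Nat.exists_eq_succ_of_ne_zero hpos
  have hmin := Nat.find_min hex (m := N) (by omega)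
  push Not at hmin
  obtain ⟨v, hv⟩ := hmin
  refine ⟨N, v, hv, ?_⟩
  have := Nat.find_spec hex
  rwa [hN] at this

/-- The span of all elements but the last ones of the chains of length `n k` generated by `v k`. -/
def initSpan (f : Module.End D V) {κ : Type*} (n : κ → ℕ) (v : κ → V) : Submodule D V :=
  Submodule.span D {w | ∃ j i, i + 1 < n j ∧ w = (f ^ i) (v j)}

theorem map_initSpan {W : Type*} [AddCommGroup W] [Module D W] (f : Module.End D V)
    (g : Module.End D W) (φ : V →ₗ[D] W) (h : ∀ i x, φ ((f ^ i) x) = (g ^ i) (φ x))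
    {κ : Type*} (n : κ → ℕ) (v : κ → V) :
    (initSpan f n v).map φ = initSpan g n (φ ∘ v) := by
  rw [initSpan, initSpan, Submodule.map_span]
  congr 1
  ext w
  constructor
  · rintro ⟨_, ⟨j, i, hi, rfl⟩, rfl⟩
    exact ⟨j, i, hi, h _ _⟩
  · rintro ⟨j, i, hi, rfl⟩
    exact ⟨_, ⟨j, i, hi, rfl⟩, h _ _⟩

/-- Correcting a lift of a chain generator by a vector of a longest chain generated by `v`. -/
theorem exists_chain_correction {f : Module.End D V} {N : ℕ} {v : V}
    (hN : ∀ x, (f ^ (N + 1)) x ∈ chainSpan f x (N + 1)) {S : Submodule D V} {u : V} {m : ℕ}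
    (hm0 : 0 < m) (hm : m ≤ N + 1) (hS : ∀ i, i + 1 < m → (f ^ i) u ∈ S) {c : D}
    (hc : (f ^ m) u - c • (f ^ (m - 1)) u ∈ S ⊔ chainSpan f v (N + 1)) :
    ∃ t ∈ chainSpan f v (N + 1), (∀ i < m, (f ^ i) t ∈ chainSpan f v N) ∧
      ∃ c : D, (f ^ m) (u + t) - c • (f ^ (m - 1)) (u + t) ∈ S ⊔ chainSpan f v N := by
  obtain ⟨m, rfl⟩ := Nat.exists_eq_succ_of_ne_zero hm0.ne'
  rw [Nat.succ_eq_add_one, Nat.add_sub_cancel] at *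
  rcases hm.lt_or_eq with hlt | heq
  · obtain ⟨s, hs, r, hr, hsr⟩ := Submodule.mem_sup.1 hc
    obtain ⟨a, y, hy, rfl⟩ := exists_smul_add_of_mem_chainSpan_succ hr
    have hpow : ∀ i, (f ^ i) (-a • (f ^ (N - (m + 1))) v) =
        -a • (f ^ (i + (N - (m + 1)))) v := by
      intro i
      rw [map_smul, ← Module.End.mul_apply, ← pow_add]
    refine ⟨-a • (f ^ (N - (m + 1))) v,
      Submodule.smul_mem _ _ (pow_apply_mem_chainSpan f v (by omega)), ?_, c, ?_⟩
    · intro i hi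
      rw [hpow]
      exact Submodule.smul_mem _ _ (pow_apply_mem_chainSpan f v (by omega))
    · have h1 : m + 1 + (N - (m + 1)) = N := by omega
      have key : (f ^ (m + 1)) (u + -a • (f ^ (N - (m + 1))) v) -
          c • (f ^ m) (u + -a • (f ^ (N - (m + 1))) v) =
          s + (y - c • (-a • (f ^ (m + (N - (m + 1)))) v)) := by
        rw [map_add, map_add, hpow, hpow, h1, smul_add, neg_smul a ((f ^ N) v)]
        have : (f ^ (m + 1)) u = s + (a • (f ^ N) v + y) + c • (f ^ m) u := by
          rw [hsr]; abel
        rw [this]; abel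
      rw [key]
      exact Submodule.add_mem_sup hs (sub_mem hy (Submodule.smul_mem _ _
        (Submodule.smul_mem _ _ (pow_apply_mem_chainSpan f v (by omega)))))
  · obtain ⟨a, y, hy, hay⟩ := exists_smul_add_of_mem_chainSpan_succ (heq ▸ hN u)
    refine ⟨0, zero_mem _, by simp, a, Submodule.mem_sup_left ?_⟩
    rw [add_zero, hay, add_sub_cancel_left]
    refine (Submodule.span_le.2 ?_ : chainSpan f u m ≤ S) hy
    rintro _ ⟨i, hi, rfl⟩
    exact hS i (Nat.succ_lt_succ hi)

/-- Every endomorphism has a basis made of chains, the image of the last vector of each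
chain having no component along the last vectors of the other chains. -/
theorem exists_chain_basis {D V : Type*} [DivisionRing D] [AddCommGroup V] [Module D V]
    [FiniteDimensional D V] (f : Module.End D V) :
    ∃ (κ : Type) (n : κ → ℕ) (v : κ → V) (b : Basis (Σ k, Fin (n k)) D V),
      (∀ k, 0 < n k) ∧ (∀ x, b x = (f ^ (x.2 : ℕ)) (v x.1)) ∧
      ∀ k, ∃ c : D, (f ^ n k) (v k) - c • (f ^ (n k - 1)) (v k) ∈ initSpan f n v := by
  induction hd : finrank D V using Nat.strong_induction_on generalizing V with
  | _ d ih =>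
  subst hd
  rcases subsingleton_or_nontrivial V with hV | hV
  · exact ⟨Empty, Empty.elim, Empty.elim, Basis.empty V, fun k => k.elim, fun x => x.1.elim,
      fun k => k.elim⟩
  obtain ⟨N, v₁, hv₁, hN⟩ := exists_longest_chain f
  set U := chainSpan f v₁ (N + 1) with hU
  have hUf : U ≤ U.comap f := chainSpan_le_comap (hN v₁)
  have hli₁ := linearIndependent_chain hv₁
  have hUpos : 0 < finrank D U := by
    have : Nontrivial U := by
      refine ⟨⟨⟨v₁, pow_apply_mem_chainSpan f v₁ N.succ_pos⟩, 0, ?_⟩⟩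
      intro h
      exact hli₁.ne_zero 0 (by simpa using congrArg Subtype.val h)
    exact finrank_pos
  have hmk : ∀ i x, U.mkQ ((f ^ i) x) = (U.mapQ U f hUf ^ i) (U.mkQ x) := by
    intro i x
    rw [← Submodule.mapQ_pow]
    rfl
  obtain ⟨κ, n, w, b, hn, hb, hlast⟩ := ih (finrank D (V ⧸ U))
    (by have := Submodule.finrank_quotient_add_finrank U; omega) (U.mapQ U f hUf) rfl
  choose u hu using fun k => U.mkQ_surjective (w k)
  have hu' : U.mkQ ∘ u = w := funext hu
  have hnN : ∀ k, n k ≤ N + 1 := by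
    intro k
    have hli : LinearIndependent D
        (fun i : Fin (n k) => (U.mapQ U f hUf ^ (i : ℕ)) (w k)) := by
      have := b.linearIndependent.comp (fun i : Fin (n k) => (⟨k, i⟩ : Σ k, Fin (n k)))
        (sigma_mk_injective (β := fun k => Fin (n k)) (i := k))
      simpa only [Function.comp_def, hb] using this
    refine le_of_linearIndependent_chain hli ?_
    have := Submodule.mem_map_of_mem (f := U.mkQ) (hN (u k))
    rw [hmk, hu, chainSpan, Submodule.map_span, ← Set.image_comp] at this
    have hcomp : (U.mkQ ∘ fun i => (f ^ i) (u k)) =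
        fun i => (U.mapQ U f hUf ^ i) (w k) := by
      funext i
      simp only [Function.comp, hmk, hu]
    rwa [hcomp] at this
  have hcor : ∀ k, ∃ t ∈ U, (∀ i < n k, (f ^ i) t ∈ chainSpan f v₁ N) ∧
      ∃ c : D, (f ^ n k) (u k + t) - c • (f ^ (n k - 1)) (u k + t) ∈
        initSpan f n u ⊔ chainSpan f v₁ N := by
    intro k
    obtain ⟨c, hc⟩ := hlast k
    refine exists_chain_correction hN (hn k) (hnN k)
      (fun i hi => Submodule.subset_span ⟨k, i, hi, rfl⟩) (c := c) ?_
    rw [← hu', ← map_initSpan f _ U.mkQ hmk, Function.comp_apply, ← hmk, ← hmk, ← map_smul,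
      ← map_sub, ← Submodule.mem_comap, Submodule.comap_map_mkQ, sup_comm] at hc
    exact hc
  choose t htU ht c hc using hcor
  let n' : Unit ⊕ κ → ℕ := Sum.elim (fun _ => N + 1) n
  let v' : Unit ⊕ κ → V := Sum.elim (fun _ => v₁) fun k => u k + t k
  let g : (Σ k, Fin (n k)) → V := fun x => (f ^ (x.2 : ℕ)) (u x.1 + t x.1)
  have hmkg : U.mkQ ∘ g = b := by
    funext x
    have h0 : U.mkQ (t x.1) = 0 := (Submodule.Quotient.mk_eq_zero U).2 (htU _)
    rw [Function.comp_apply, hmk, map_add, h0, add_zero, hu, hb]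
  let e : (Σ k, Fin (n' k)) ≃ Fin (N + 1) ⊕ Σ k, Fin (n k) :=
    (Equiv.sumSigmaDistrib _).trans
      (Equiv.sumCongr (Equiv.uniqueSigma fun _ : Unit => Fin (N + 1)) (Equiv.refl _))
  let F : Fin (N + 1) → U := fun i => ⟨(f ^ (i : ℕ)) v₁, pow_apply_mem_chainSpan f v₁ i.2⟩
  have hF : LinearIndependent D F := LinearIndependent.of_comp U.subtype hli₁
  have hli : LinearIndependent D (Sum.elim (fun i => (F i : V)) g) :=
    hF.sumElim_of_quotient g (by
      have := b.linearIndependent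
      rw [← hmkg] at this
      exact this)
  have hspan : ⊤ ≤ Submodule.span D (Set.range (Sum.elim (fun i => (F i : V)) g)) := by
    rw [Set.Sum.elim_range, Submodule.span_union]
    have h1 : Submodule.span D (Set.range fun i => (F i : V)) = U := by
      exact congrArg (Submodule.span D) (range_chain f v₁ (N + 1))
    rw [h1, top_le_iff, ← Submodule.map_mkQ_eq_top, Submodule.map_span, ← Set.range_comp, hmkg,
      b.span_eq]
  have hsup : initSpan f n u ⊔ chainSpan f v₁ N ≤ initSpan f n' v' := by
    have h2 : chainSpan f v₁ N ≤ initSpan f n' v' := by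
      refine Submodule.span_le.2 ?_
      rintro _ ⟨i, hi, rfl⟩
      exact Submodule.subset_span ⟨Sum.inl (), i, Nat.succ_lt_succ hi, rfl⟩
    refine sup_le (Submodule.span_le.2 ?_) h2
    rintro _ ⟨j, i, hi, rfl⟩
    have h3 : (f ^ i) (u j + t j) ∈ initSpan f n' v' :=
      Submodule.subset_span ⟨Sum.inr j, i, hi, rfl⟩
    rw [map_add] at h3
    simpa using sub_mem h3 (h2 (ht j i (by omega)))
  refine ⟨Unit ⊕ κ, n', v', (Basis.mk hli hspan).reindex e.symm, ?_, ?_, ?_⟩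
  · rintro (_ | k)
    · exact N.succ_pos
    · exact hn k
  · rintro ⟨_ | k, i⟩ <;> simp [Basis.reindex_apply] <;> rfl
  · rintro (_ | k)
    · obtain ⟨a, y, hy, hay⟩ := exists_smul_add_of_mem_chainSpan_succ (hN v₁)
      refine ⟨a, hsup (Submodule.mem_sup_right ?_)⟩
      change (f ^ (N + 1)) v₁ - a • (f ^ N) v₁ ∈ _
      rwa [hay, add_sub_cancel_left]
    · exact ⟨c k, hsup (hc k)⟩

end Chains

/-- If a basis is made of chains of `f` ending at the vectors with `ht = 0`, then `f` is the sum of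
two endomorphisms which act on the basis by pairing consecutive vectors of the chains. -/
theorem exists_add_eigenspan_eq_top_of_basis {D V ι : Type*} [DivisionRing D] [AddCommGroup V]
    [Module D V] {f : Module.End D V} (b : Basis ι D V) {S : Set D} (hS : S ⊆ Set.center D)
    (ht : ι → ℕ) (p : ι → D) (hp : ∀ x, p x ∈ Set.center D) (hpS : ∀ x, ht x ≠ 0 → -p x ∈ S)
    (hnext : ∀ x, ht x ≠ 0 → ∃ y, f (b x) = b y ∧ ht y + 1 = ht x ∧ p y ≠ p x)
    (hlast : ∀ x, ht x = 0 → ∃ c, c - p x ∉ S ∧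
      f (b x) - c • b x ∈ Submodule.span D (b '' {y | ht y ≠ 0})) :
    ∃ g h : Module.End D V, eigenspan g Set.univ = ⊤ ∧ eigenspan h Set.univ = ⊤ ∧ f = g + h := by
  obtain ⟨g, hg⟩ : ∃ g : Module.End D V,
      ∀ x, g (b x) = p x • b x + if Odd (ht x) then f (b x) else 0 :=
    ⟨b.constr ℕ fun x => p x • b x + if Odd (ht x) then f (b x) else 0,
      fun x => b.constr_basis ℕ _ x⟩
  have hg_odd : ∀ x, Odd (ht x) → g (b x) = p x • b x + f (b x) := fun x hx => by
    rw [hg, if_pos hx]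
  have hg_even : ∀ x, ¬ Odd (ht x) → g (b x) = p x • b x := fun x hx => by
    rw [hg, if_neg hx, add_zero]
  have htop : ∀ φ : Module.End D V, (∀ x, b x ∈ eigenspan φ Set.univ) →
      eigenspan φ Set.univ = ⊤ := by
    intro φ h
    rw [← top_le_iff, ← b.span_eq]
    exact Submodule.span_le.2 (by rintro _ ⟨x, rfl⟩; exact h x)
  have hpair : ∀ (φ : Module.End D V) (T : Set D) (a a' : D) (x y : V), a ∈ T → a' ∈ T →
      a' ∈ Set.center D → a ≠ a' → φ x = a • x + y → φ y = a' • y → x ∈ eigenspan φ T := by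
    intro φ T a a' x y ha ha' hcen' hne' hx hy
    exact mem_eigenspan_of_apply_eq (S := {a'}) (Set.singleton_subset_iff.2 hcen')
      (Set.singleton_subset_iff.2 ha') hne' ha (mem_eigenspan (Set.mem_singleton a') hy) hx
  have hh : ∀ x, ht x ≠ 0 → b x ∈ eigenspan (f - g) S := by
    intro x hx
    by_cases hodd : Odd (ht x)
    · refine mem_eigenspan (hpS x hx) ?_
      rw [LinearMap.sub_apply, hg_odd x hodd, neg_smul]
      abel
    · obtain ⟨y, hy, hxy, hpne⟩ := hnext x hx
      have hodd' : Odd (ht y) := by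
        rw [← hxy, Nat.odd_add_one, not_not] at hodd
        exact hodd
      have hy0 : ht y ≠ 0 := fun h => by simp [h] at hodd'
      refine hpair _ _ (-p x) (-p y) _ (b y) (hpS x hx) (hpS y hy0)
        (hS (hpS y hy0)) (fun h => hpne (neg_injective h).symm) ?_ ?_
      · rw [LinearMap.sub_apply, hg_even x hodd, hy, neg_smul]
        abel
      · rw [LinearMap.sub_apply, hg_odd y hodd', neg_smul]
        abel
  refine ⟨g, f - g, htop _ fun x => ?_, htop _ fun x => ?_, by abel⟩
  · by_cases hodd : Odd (ht x)
    · have hx : ht x ≠ 0 := fun h => by simp [h] at hodd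
      obtain ⟨y, hy, hxy, hpne⟩ := hnext x hx
      have hodd' : ¬ Odd (ht y) := by
        rwa [← hxy, Nat.odd_add_one] at hodd
      refine hpair g _ (p x) (p y) _ (b y) (Set.mem_univ _) (Set.mem_univ _)
        (hp y) hpne.symm ?_ ?_
      · rw [hg_odd x hodd, hy]
      · rw [hg_even y hodd']
    · exact mem_eigenspan (Set.mem_univ (p x)) (hg_even x hodd)
  · by_cases hx : ht x = 0
    · obtain ⟨c, hc, hw⟩ := hlast x hx
      have hle : Submodule.span D (b '' {y | ht y ≠ 0}) ≤ eigenspan (f - g) S :=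
        Submodule.span_le.2 (by rintro _ ⟨y, hy, rfl⟩; exact hh y hy)
      refine mem_eigenspan_of_apply_eq hS (Set.subset_univ _) hc (Set.mem_univ _) (hle hw) ?_
      rw [LinearMap.sub_apply, hg_even x (by simp [hx]), sub_smul]
      abel
    · exact eigenspan_mono _ (Set.subset_univ _) (hh x hx)

theorem exists_add_eigenspan_eq_top {D V : Type*} [DivisionRing D] [AddCommGroup V] [Module D V]
    [FiniteDimensional D V] {β γ : D}
    (hβ : β ∈ Set.center D) (hγ : γ ∈ Set.center D) (hne : β ≠ γ)
    (h3 : ∀ x ∈ Set.center D, ∀ y ∈ Set.center D, ∃ z ∈ Set.center D, z ≠ x ∧ z ≠ y)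
    (f : Module.End D V) :
    ∃ g h : Module.End D V, eigenspan g Set.univ = ⊤ ∧ eigenspan h Set.univ = ⊤ ∧ f = g + h := by
  obtain ⟨κ, n, v, b, hn, hb, hlast⟩ := exists_chain_basis f
  choose c hc using hlast
  choose s hs s' hs' r hr hss hrs hcr using fun k => exists_diagonal_choice hβ hγ hne h3 (c k)
  have hcen : ∀ x ∈ ({β, γ} : Set D), x ∈ Set.center D := by
    rintro x (rfl | rfl) <;> assumption
  have hneg : ∀ x ∈ ({β, γ} : Set D), -x ∈ ({-β, -γ} : Set D) := by
    rintro x (rfl | rfl) <;> simp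
  have hS : ({-β, -γ} : Set D) ⊆ Set.center D := by
    rintro x (rfl | rfl) <;> exact Set.neg_mem_center ‹_›
  -- the diagonal entry of the first summand at distance `m` to the end of the chain `k`
  let P : κ → ℕ → D := fun k m => if m = 0 then r k else if Odd m then s k else s' k
  have hP : ∀ k m, P k m ≠ P k (m + 1) := by
    intro k m
    by_cases h0 : m = 0
    · simpa [P, h0] using hrs k
    · by_cases h1 : Odd m
      · simpa [P, h0, h1, Nat.odd_add_one] using (hss k).symm
      · simpa [P, h0, h1, Nat.odd_add_one] using hss k
  have hsucc : ∀ k i (hi : i < n k), f (b ⟨k, i, hi⟩) = (f ^ (i + 1)) (v k) := by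
    intro k i hi
    rw [hb, ← Module.End.mul_apply, ← pow_succ']
  refine exists_add_eigenspan_eq_top_of_basis b hS (fun x => n x.1 - 1 - x.2)
    (fun x => P x.1 (n x.1 - 1 - x.2)) ?_ ?_ ?_ ?_
  · intro x
    simp only [P]
    split_ifs
    exacts [hr _, hcen _ (hs _), hcen _ (hs' _)]
  · intro x hx
    simp only [P, if_neg hx]
    split_ifs
    exacts [hneg _ (hs _), hneg _ (hs' _)]
  · rintro ⟨k, i, hi⟩ hx
    dsimp only at hx ⊢
    refine ⟨⟨k, i + 1, by omega⟩, ?_, ?_, ?_⟩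
    · rw [hsucc, hb]
    · dsimp only
      omega
    · have h1 : n k - 1 - i = n k - 1 - (i + 1) + 1 := by omega
      dsimp only
      rw [h1]
      exact hP k _
  · rintro ⟨k, i, hi⟩ hx
    dsimp only at hx ⊢
    have hik : n k = i + 1 := by omega
    refine ⟨c k, by rw [hx]; exact hcr k, ?_⟩
    have hck := hc k
    have hik' : n k - 1 = i := by omega
    rw [hik'] at hck
    rw [hsucc, hb, ← hik]
    refine (Submodule.span_mono ?_ : initSpan f n v ≤ _) hck
    rintro _ ⟨j, l, hl, rfl⟩
    refine ⟨⟨j, l, by omega⟩, ?_, hb _⟩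
    change n j - 1 - l ≠ 0
    omega

/-- If the center of a division ring D contains at least three elements, every
    n×n matrix over D is a sum of two diagonalizable matrices. -/
theorem stmt_7 (D : Type*) [DivisionRing D]
    (hcenter : 3 ≤ Cardinal.mk (Subring.center D))
    {n : ℕ} (hn : 0 < n) (A : Matrix (Fin n) (Fin n) D) :
    ∃ B C : Matrix (Fin n) (Fin n) D,
      IsDiagonalizable B ∧ IsDiagonalizable C ∧ A = B + C := by
  have h3 : ∀ x ∈ Set.center D, ∀ y ∈ Set.center D, ∃ z ∈ Set.center D, z ≠ x ∧ z ≠ y := by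
    intro x hx y hy
    obtain ⟨z, hzx, hzy⟩ := Cardinal.exists_ne_ne_of_three_le hcenter ⟨x, hx⟩ ⟨y, hy⟩
    exact ⟨z, z.2, fun h => hzx (Subtype.ext h), fun h => hzy (Subtype.ext h)⟩
  obtain ⟨g, h, hg, hh, hA⟩ := exists_add_eigenspan_eq_top (V := Fin n → D)
    Set.one_mem_center Set.zero_mem_center one_ne_zero h3 A.vecMulLinear
  have hmat : ∀ φ : Module.End D (Fin n → D),
      (Matrix.toLinearMapRight'.symm φ).vecMulLinear = φ := fun φ =>
    Matrix.toLinearMapRight'.apply_symm_apply φ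
  refine ⟨Matrix.toLinearMapRight'.symm g, Matrix.toLinearMapRight'.symm h,
    isDiagonalizable_of_eigenspan _ (by rwa [hmat]),
    isDiagonalizable_of_eigenspan _ (by rwa [hmat]), ?_⟩
  rw [← map_add, ← hA]
  exact (Matrix.toLinearMapRight'.symm_apply_apply A).symm
end

section
/- Let D be a division ring whose center is the field with two elements, and let n be a positive integer. Then every n×n matrix over D can be written as a sum of three diagonalizable matrices over D. -/
open Module Submodule

universe u

/-- The eigenvectors of `g` span the whole space. -/
def EigenvectorsSpan {D : Type*} [DivisionRing D] {V : Type*} [AddCommGroup V] [Module D V]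
    (g : End D V) : Prop :=
  span D {v | ∃ a : D, g v = a • v} = ⊤

/-- `f` is the sum of a diagonalizable and a nilpotent endomorphism. -/
def IsDiagAddNilpotent {D : Type*} [DivisionRing D] {V : Type*} [AddCommGroup V] [Module D V]
    (f : End D V) : Prop :=
  ∃ g : End D V, EigenvectorsSpan g ∧ IsNilpotent (f - g)

section

variable {D : Type*} [DivisionRing D] {V : Type*} [AddCommGroup V] [Module D V]

theorem mem_span_eigenvectors {g : End D V} {v : V} (a : D) (h : g v = a • v) :
    v ∈ span D {v | ∃ a : D, g v = a • v} :=
  subset_span ⟨a, h⟩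

theorem EigenvectorsSpan.neg {g : End D V} (h : EigenvectorsSpan g) : EigenvectorsSpan (-g) := by
  refine top_unique (h.ge.trans (span_mono ?_))
  rintro v ⟨a, ha⟩
  exact ⟨-a, by simp [ha]⟩

/-- A nilpotent endomorphism is odd for some `ℤ/2`-grading, refined here to control one piece. -/
theorem exists_odd_grading_ker_pow (f : End D V) (k : ℕ) (W : Submodule D V)
    (hW : W ≤ LinearMap.ker (f ^ (k + 1))) (hd : Disjoint W (LinearMap.ker (f ^ k))) :
    ∃ Y Y' : Submodule D V, W ≤ Y ∧ Y ⊔ Y' = LinearMap.ker (f ^ (k + 1)) ∧ Disjoint Y Y' ∧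
      Y.map f ≤ Y' ∧ Y'.map f ≤ Y := by
  induction k generalizing W with
  | zero =>
    refine ⟨LinearMap.ker f, ⊥, by simpa using hW, by simp, disjoint_bot_right, ?_, by simp⟩
    rintro _ ⟨x, hx, rfl⟩
    simpa using hx
  | succ k ih =>
    obtain ⟨Z₀, hWZ, hZ₀⟩ := hd.exists_isCompl
    set K := LinearMap.ker (f ^ (k + 1)) with hK
    set L := LinearMap.ker (f ^ (k + 1 + 1)) with hL
    have hKL : K ≤ L := fun x hx => by
      rw [hL, LinearMap.mem_ker, pow_succ', Module.End.mul_apply, LinearMap.mem_ker.1 hx, map_zero]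
    have hsup : (Z₀ ⊓ L) ⊔ K = L := by
      rw [sup_comm, inf_comm Z₀ L, inf_comm L Z₀, ← sup_inf_assoc_of_le Z₀ hKL, sup_comm,
        hZ₀.sup_eq_top, top_inf_eq]
    have hdisj : Disjoint (Z₀ ⊓ L) K := hZ₀.disjoint.mono_left inf_le_left
    obtain ⟨Y, Y', h1, h2, h3, h4, h5⟩ := ih ((Z₀ ⊓ L).map f) (by
        rintro _ ⟨x, hx, rfl⟩
        have := hx.2
        rwa [SetLike.mem_coe, hL, LinearMap.mem_ker, pow_succ, Module.End.mul_apply] at this) (by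
        rw [Submodule.disjoint_def]
        rintro _ ⟨x, hx, rfl⟩ hx'
        have hxK : x ∈ K := by
          rwa [hK, LinearMap.mem_ker, pow_succ, Module.End.mul_apply]
        rw [Submodule.disjoint_def.1 hdisj x hx hxK, map_zero])
    refine ⟨(Z₀ ⊓ L) ⊔ Y', Y, le_sup_of_le_left (le_inf hWZ hW), ?_, ?_, ?_, h4.trans le_sup_right⟩
    · rw [sup_assoc, sup_comm Y', h2, hsup]
    · rw [← h2, sup_comm] at hdisj
      exact h3.symm.disjoint_sup_left_of_disjoint_sup_right hdisj
    · rw [Submodule.map_sup]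
      exact sup_le h1 h5

/-- A nilpotent endomorphism is a difference of two idempotents, which are diagonalizable. -/
theorem exists_eq_sub_of_isNilpotent {f : End D V} (hf : IsNilpotent f) :
    ∃ p q : End D V, EigenvectorsSpan p ∧ EigenvectorsSpan q ∧ f = p - q := by
  obtain ⟨k, hk⟩ := hf
  obtain ⟨Y, Y', -, h1, h2, h3, h4⟩ := exists_odd_grading_ker_pow f k ⊥ bot_le disjoint_bot_left
  rw [pow_succ, hk, zero_mul, LinearMap.ker_zero] at h1
  have hc : IsCompl Y Y' := ⟨h2, codisjoint_iff.2 h1⟩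
  set π : End D V := Y.projection Y' hc
  have hl : ∀ y ∈ Y, π y = y := fun y hy => projection_apply_of_mem_left hc hy
  have hr : ∀ y ∈ Y', π y = 0 := fun y hy => (projection_apply_eq_zero_iff hc).2 hy
  have hfl : ∀ y ∈ Y, f y ∈ Y' := fun y hy => h3 ⟨y, hy, rfl⟩
  have hfr : ∀ y ∈ Y', f y ∈ Y := fun y hy => h4 ⟨y, hy, rfl⟩
  refine ⟨π + f * (1 - π), π - f * π, ?_, ?_, by noncomm_ring⟩
  · refine top_unique (h1.ge.trans (sup_le (fun y hy => ?_) (fun y hy => ?_)))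
    · exact mem_span_eigenvectors 1 (by simp [hl y hy])
    · rw [← sub_add_cancel y (f y)]
      refine add_mem (mem_span_eigenvectors 0 ?_) (mem_span_eigenvectors 1 ?_)
      · simp [hr y hy, hl _ (hfr y hy)]
      · simp [hl _ (hfr y hy)]
  · refine top_unique (h1.ge.trans (sup_le (fun y hy => ?_) (fun y hy => ?_)))
    · rw [← sub_add_cancel y (f y)]
      refine add_mem (mem_span_eigenvectors 1 ?_) (mem_span_eigenvectors 0 ?_)
      · simp [hl y hy, hr _ (hfl y hy)]
      · simp [hr _ (hfl y hy)]
    · exact mem_span_eigenvectors 0 (by simp [hr y hy])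

theorem isNilpotent_of_basis {ι : Type*} [Fintype ι] (b : Basis ι D V) (N : End D V)
    (h : ∀ i, ∃ k : ℕ, (N ^ k) (b i) = 0) : IsNilpotent N := by
  classical
  choose k hk using h
  refine ⟨∑ i, k i, b.ext fun i => ?_⟩
  rw [← Finset.sum_erase_add _ _ (Finset.mem_univ i), pow_add, Module.End.mul_apply, hk]
  simp

/-- The block triangular step. -/
theorem IsDiagAddNilpotent.of_isCompl {f : End D V} {W U : Submodule D V} (hc : IsCompl W U)
    (hW : ∀ x ∈ W, f x ∈ W) (h1 : IsDiagAddNilpotent (f.restrict hW))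
    (h2 : IsDiagAddNilpotent (U.projectionOnto W hc.symm ∘ₗ f ∘ₗ U.subtype)) :
    IsDiagAddNilpotent f := by
  obtain ⟨g, hg, k, hk⟩ := h1
  obtain ⟨g', hg', l, hl⟩ := h2
  set π := U.projectionOnto W hc.symm
  set G : End D V := LinearMap.ofIsCompl hc (W.subtype ∘ₗ g) (U.subtype ∘ₗ g')
  have hGW : ∀ x : W, G x = g x := fun x => LinearMap.ofIsCompl_apply_left hc x
  have hGU : ∀ x : U, G x = g' x := fun x => LinearMap.ofIsCompl_apply_right hc x
  refine ⟨G, ?_, k + l, ?_⟩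
  · refine top_unique (hc.sup_eq_top.ge.trans (sup_le ?_ ?_))
    · have := congrArg (Submodule.map W.subtype) hg
      rw [Submodule.map_span, Submodule.map_top, range_subtype] at this
      rw [← this]
      refine span_mono ?_
      rintro _ ⟨x, ⟨a, ha⟩, rfl⟩
      exact ⟨a, by simp [hGW, ha]⟩
    · have := congrArg (Submodule.map U.subtype) hg'
      rw [Submodule.map_span, Submodule.map_top, range_subtype] at this
      rw [← this]
      refine span_mono ?_
      rintro _ ⟨x, ⟨a, ha⟩, rfl⟩
      exact ⟨a, by simp [hGU, ha]⟩
  · have hπW : ∀ x : W, π x = 0 := fun x => projectionOnto_apply_right hc.symm x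
    have hπU : ∀ x : U, π x = x := fun x => projectionOnto_apply_left hc.symm x
    have hNW : ∀ (x : W), (f - G) x = ((f.restrict hW - g) x : W) := fun x => by simp [hGW]
    have hNWk : ∀ (j : ℕ) (x : W), ((f - G) ^ j) x = (((f.restrict hW - g) ^ j) x : W) := by
      intro j
      induction j with
      | zero => simp
      | succ j ih => intro x; rw [pow_succ, Module.End.mul_apply, hNW, ih, pow_succ]; rfl
    have hNU : ∀ x : V, π ((f - G) x) = (π ∘ₗ f ∘ₗ U.subtype - g') (π x) := by
      intro x
      obtain ⟨w, hw, y, hy, rfl⟩ := Submodule.mem_sup.1 (hc.sup_eq_top.ge (mem_top (x := x)))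
      lift w to W using hw
      lift y to U using hy
      have e1 := hNW w
      simp only [map_add, e1, hπW, hπU, zero_add]
      simp [hGU, hπU]
    have hNUk : ∀ (j : ℕ) (x : V),
        π (((f - G) ^ j) x) = ((π ∘ₗ f ∘ₗ U.subtype - g') ^ j) (π x) := by
      intro j
      induction j with
      | zero => simp
      | succ j ih =>
        intro x
        rw [pow_succ, Module.End.mul_apply, ih, hNU, pow_succ, Module.End.mul_apply]
    ext x
    have hx : ((f - G) ^ l) x ∈ W := by
      rw [← projectionOnto_apply_eq_zero_iff hc.symm]
      rw [hNUk, hl]; rfl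
    rw [pow_add, Module.End.mul_apply]
    have := hNWk k ⟨_, hx⟩
    rw [hk] at this
    simpa using this

/-- A cyclic endomorphism of nonzero trace (last coefficient of the companion matrix). -/
theorem isDiagAddNilpotent_of_cyclic_of_ne_zero {m : ℕ} (B : Basis (Fin (m + 1)) D V)
    {f : End D V} {v : V} (hB : ∀ i, B i = (f ^ (i : ℕ)) v)
    (hc : B.repr (f (B (Fin.last m))) (Fin.last m) ≠ 0) : IsDiagAddNilpotent f := by
  set N : End D V := B.constr ℕ (fun i => if i = Fin.last m then 0 else f (B i)) with hN
  have hNB : ∀ i, N (B i) = if i = Fin.last m then 0 else f (B i) := fun i => by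
    rw [hN, Basis.constr_basis]
  refine ⟨f - N, ?_, ?_⟩
  · set w := f (B (Fin.last m)) with hw
    have hlast : (f - N) (B (Fin.last m)) = w := by simp [hNB, hw]
    have h0 : ∀ i : Fin m, (f - N) (B i.castSucc) = 0 := fun i => by
      simp [hNB, (Fin.castSucc_lt_last i).ne]
    have hsum := B.sum_repr w
    rw [Fin.sum_univ_castSucc] at hsum
    have hgw : (f - N) w = B.repr w (Fin.last m) • w := by
      conv_lhs => rw [← hsum]
      rw [map_add, map_sum, map_smul, hlast]
      simp [-LinearMap.sub_apply, h0]
    have hmem : ∀ i : Fin m, B i.castSucc ∈ span D {v | ∃ a : D, (f - N) v = a • v} :=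
      fun i => mem_span_eigenvectors 0 (by rw [h0, zero_smul])
    refine top_unique (B.span_eq.ge.trans (span_le.2 ?_))
    rintro _ ⟨i, rfl⟩
    refine Fin.lastCases ?_ hmem i
    have h1 := sub_mem (mem_span_eigenvectors _ hgw)
      (sum_mem fun (i : Fin m) (_ : i ∈ Finset.univ) =>
        smul_mem _ (B.repr w i.castSucc) (hmem i))
    rw [← eq_sub_iff_add_eq'] at hsum
    rw [← hsum] at h1
    exact (smul_mem_iff _ hc).1 h1
  · rw [sub_sub_cancel]
    have key : ∀ (k : ℕ) (i : Fin (m + 1)), i + k = m + 1 → (N ^ k) (B i) = 0 := by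
      intro k
      induction k with
      | zero => intro i hi; omega
      | succ k ih =>
        intro i hi
        rw [pow_succ, Module.End.mul_apply, hNB]
        split_ifs with h
        · simp
        · have hlt : (i : ℕ) + 1 < m + 1 := by
            have := Fin.val_ne_of_ne h
            simp at this
            omega
          have : f (B i) = B ⟨i + 1, hlt⟩ := by
            rw [hB, hB, ← Module.End.mul_apply, ← pow_succ']
          rw [this, ih _ (by simp; omega)]
    exact isNilpotent_of_basis B N fun i => ⟨m + 1 - i, key _ i (by omega)⟩

/-- A cyclic endomorphism of trace zero in dimension at least three, in characteristic two. -/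
theorem isDiagAddNilpotent_of_cyclic_of_eq_zero (h2 : (2 : D) = 0) {m : ℕ}
    (B : Basis (Fin (m + 3)) D V) {f : End D V} {v : V} (hB : ∀ i, B i = (f ^ (i : ℕ)) v)
    (hc : B.repr (f (B (Fin.last (m + 2)))) (Fin.last (m + 2)) = 0) : IsDiagAddNilpotent f := by
  have hneg : ∀ x : V, -x = x := fun x => by
    rw [neg_eq_iff_add_eq_zero, ← two_smul D, h2, zero_smul]
  set e : Fin (m + 1) → V := fun i => B i.castSucc.castSucc with he
  set x := B (Fin.last (m + 1)).castSucc with hx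
  set y := B (Fin.last (m + 2)) with hy
  set c := B.repr (f y) (Fin.last (m + 1)).castSucc
  set t := c + 1 with ht
  set b := y - x - t • e (Fin.last m) with hb
  have hfe : ∀ i : Fin m, f (e i.castSucc) = e i.succ := fun i => by
    simp only [he, hB, ← Module.End.mul_apply, ← pow_succ']
    simp
  have hfel : f (e (Fin.last m)) = x := by
    simp only [he, hx, hB, ← Module.End.mul_apply, ← pow_succ']
    simp
  have hfx : f x = y := by
    simp only [hy, hx, hB, ← Module.End.mul_apply, ← pow_succ']
    simp
  obtain ⟨N, hNe, hNx, hNy⟩ : ∃ N : End D V, (∀ i, N (e i) = f (e i)) ∧ N x = b ∧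
      N y = b + t • x := by
    refine ⟨B.constr ℕ (Fin.snoc (Fin.snoc (fun i => f (e i)) b : Fin (m + 2) → V) (b + t • x) :
      Fin (m + 3) → V), fun i => ?_, ?_, ?_⟩
    · simp only [he, Basis.constr_basis, Fin.snoc_castSucc]
    · simp only [hx, Basis.constr_basis, Fin.snoc_castSucc, Fin.snoc_last]
    · simp only [hy, Basis.constr_basis, Fin.snoc_last]
  have hNb : N b = 0 := by
    rw [hb, map_sub, map_sub, map_smul, hNe, hNx, hNy, hfel]
    abel
  have hfy : f y = ∑ i, B.repr (f y) i.castSucc.castSucc • e i + c • x := by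
    conv_lhs => rw [← B.sum_repr (f y)]
    rw [Fin.sum_univ_castSucc, Fin.sum_univ_castSucc, hc, zero_smul, add_zero]
  set w := ∑ i, B.repr (f y) i.castSucc.castSucc • e i
  refine ⟨f - N, ?_, ?_⟩
  · set S := span D {v | ∃ a : D, (f - N) v = a • v}
    have hge : ∀ i, (f - N) (e i) = 0 := fun i => by simp [hNe]
    have heS : ∀ i, e i ∈ S := fun i => mem_span_eigenvectors 0 (by rw [hge, zero_smul])
    have hgx : (f - N) x = x + t • e (Fin.last m) := by
      rw [LinearMap.sub_apply, hfx, hNx, hb]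
      abel
    have hgw : (f - N) w = 0 := by
      rw [map_sum]
      exact Finset.sum_eq_zero fun i _ => by rw [map_smul, hge, smul_zero]
    have hgb : (f - N) b = b + w + t • e (Fin.last m) := by
      rw [LinearMap.sub_apply, hNb, hb, map_sub, map_sub, map_smul, hfx, hfel, hfy, ht, add_smul,
        one_smul]
      rw [← sub_eq_zero]
      calc _ = -y - y := by abel
        _ = 0 := by rw [hneg, sub_self]
    have hxS : x ∈ S := by
      rw [← add_sub_cancel_right x (t • e (Fin.last m))]
      refine sub_mem (mem_span_eigenvectors 1 ?_) (smul_mem _ _ (heS _))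
      rw [map_add, map_smul, hgx, hge]
      simp
    have hwS : w ∈ S := sum_mem fun i _ => smul_mem _ _ (heS i)
    have hbS : b ∈ S := by
      have : b + w + t • e (Fin.last m) ∈ S := by
        refine mem_span_eigenvectors 1 ?_
        rw [map_add, map_add, map_smul, hgb, hgw, hge]
        simp
      have h := sub_mem (sub_mem this (smul_mem _ t (heS (Fin.last m)))) hwS
      convert h using 1
      abel
    have hyS : y ∈ S := by
      have := add_mem (add_mem hbS hxS) (smul_mem _ t (heS (Fin.last m)))
      convert this using 1
      rw [hb]
      abel
    refine top_unique (B.span_eq.ge.trans (span_le.2 ?_))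
    rintro _ ⟨i, rfl⟩
    exact Fin.lastCases hyS (fun j => Fin.lastCases hxS heS j) i
  · rw [sub_sub_cancel]
    have hx0 : (N ^ 2) x = 0 := by rw [pow_two, Module.End.mul_apply, hNx, hNb]
    have hy0 : (N ^ 3) y = 0 := by
      rw [pow_succ, Module.End.mul_apply, hNy, map_add, map_smul, hx0, pow_two,
        Module.End.mul_apply, hNb]
      simp
    have hek : ∀ i : Fin (m + 1), ∃ k : ℕ, (N ^ k) (e i) = 0 := by
      intro i
      induction i using Fin.reverseInduction with
      | last => exact ⟨3, by rw [pow_succ, Module.End.mul_apply, hNe, hfel, hx0]⟩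
      | cast i ih =>
        obtain ⟨k, hk⟩ := ih
        exact ⟨k + 1, by rw [pow_succ, Module.End.mul_apply, hNe, hfe, hk]⟩
    refine isNilpotent_of_basis B N fun i => ?_
    exact Fin.lastCases ⟨3, hy0⟩ (fun j => Fin.lastCases ⟨2, hx0⟩ hek j) i

/-- A cyclic endomorphism of trace zero of a plane, when the center is `{0, 1}`. -/
theorem isDiagAddNilpotent_of_cyclic_two (h2 : (2 : D) = 0)
    (hcen : ∀ c : D, (∀ x, x * c = c * x) → c = 0 ∨ c = 1)
    (B : Basis (Fin 2) D V) {f : End D V} {v : V} (hB : ∀ i, B i = (f ^ (i : ℕ)) v)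
    (hc : B.repr (f (B (Fin.last 1))) (Fin.last 1) = 0) : IsDiagAddNilpotent f := by
  have hB0 : B 0 = v := by simp [hB]
  have hB1 : B 1 = f v := by simp [hB]
  set c := B.repr (f (B 1)) 0 with hc0
  have hff : f (f v) = c • v := by
    rw [← hB1, ← B.sum_repr (f (B 1)), Fin.sum_univ_two, ← hc0, hB0]
    simp only [Fin.last, Fin.reduceFinMk] at hc
    rw [hc, zero_smul, add_zero]
  by_cases hcc : ∀ x, x * c = c * x
  · rcases hcen c hcc with h | h
    · refine ⟨0, top_unique fun x _ => mem_span_eigenvectors 0 (by simp), 2, B.ext fun i => ?_⟩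
      rw [h, zero_smul] at hff
      fin_cases i <;> simp [hB0, hB1, pow_two, hff]
    · refine ⟨1, top_unique fun x _ => mem_span_eigenvectors 1 (by simp), 2, B.ext fun i => ?_⟩
      rw [h, one_smul] at hff
      have hneg : ∀ x : V, x + x = 0 := fun x => by rw [← two_smul D, h2, zero_smul]
      have h1 : v - f v - (f v - v) = 0 := by
        calc _ = (v + v) - (f v + f v) := by abel
          _ = 0 := by simp [hneg]
      have h2 : f v - v - (v - f v) = 0 := by rw [← neg_sub, neg_eq_zero] at h1; exact h1
      fin_cases i <;> simp [hB0, hB1, pow_two, hff, h1, h2]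
  · push Not at hcc
    obtain ⟨β, hβ⟩ := hcc
    have hli : ∀ s t : D, s • v + t • f v = 0 → s = 0 ∧ t = 0 := by
      have hBv : ![v, f v] = B := by
        ext i
        fin_cases i <;> simp [hB0, hB1]
      exact LinearIndependent.pair_iff.1 (hBv ▸ B.linearIndependent)
    set v' := v + β • f v with hv'
    have hfv' : f v' = (β * c) • v + f v := by
      rw [hv', map_add, map_smul, hff, smul_smul, add_comm]
    have hffv' : f (f v') = c • v + (β * c) • f v := by
      rw [hfv', map_add, map_smul, hff, add_comm]
    have hli' : LinearIndependent D ![v', f v'] := by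
      rw [LinearIndependent.pair_iff]
      intro s t hst
      obtain ⟨h3, h4⟩ := hli (s + t * (β * c)) (s * β + t) (by
        rw [← hst, hfv', hv']
        simp only [smul_add, smul_smul, add_smul]
        abel)
      have ht : t = -(s * β) := by rw [← add_eq_zero_iff_eq_neg']; exact h4
      have hs : s = 0 := by
        by_contra hs
        have h5 : s * (1 - β * (β * c)) = 0 := by
          rw [ht] at h3
          rw [← h3]
          noncomm_ring
        have h6 : β * (β * c) = 1 := by
          rcases mul_eq_zero.1 h5 with h | h
          · exact absurd h hs
          · exact (sub_eq_zero.1 h).symm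
        have h7 : β * c * β = 1 := mul_eq_one_comm.1 h6
        have hβ0 : β ≠ 0 := by rintro rfl; simp at h6
        apply hβ
        apply mul_left_cancel₀ hβ0
        rw [h6, ← mul_assoc, h7]
      exact ⟨hs, by rw [ht, hs]; simp⟩
    have hfin : finrank D V = 2 := by simpa using finrank_eq_card_basis B
    set B' : Basis (Fin 2) D V :=
      basisOfLinearIndependentOfCardEqFinrank hli' (by simp [hfin]) with hB'
    have hB'0 : B' 0 = v' := by simp [hB']
    have hB'1 : B' 1 = f v' := by simp [hB']
    refine isDiagAddNilpotent_of_cyclic_of_ne_zero (m := 1) B' (v := v') (fun i => ?_) ?_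
    · fin_cases i
      · simpa using hB'0
      · simpa using hB'1
    · intro h0
      simp only [Fin.last, Fin.reduceFinMk] at h0
      have hs := B'.sum_repr (f (B' 1))
      rw [Fin.sum_univ_two, h0, zero_smul, add_zero, hB'0, hB'1, hffv'] at hs
      set z := B'.repr (c • v + (β * c) • f v) 0
      obtain ⟨h3, h4⟩ := hli (z - c) (z * β - β * c) (by
        rw [← sub_eq_zero, hv'] at hs
        rw [← hs]
        simp only [smul_add, smul_smul, sub_smul]
        abel)
      rw [sub_eq_zero] at h3 h4
      rw [h3] at h4
      exact hβ h4.symm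

theorem isDiagAddNilpotent_of_cyclic (h2 : (2 : D) = 0)
    (hcen : ∀ c : D, (∀ x, x * c = c * x) → c = 0 ∨ c = 1) {m : ℕ}
    (B : Basis (Fin (m + 1)) D V) {f : End D V} {v : V} (hB : ∀ i, B i = (f ^ (i : ℕ)) v) :
    IsDiagAddNilpotent f := by
  by_cases hc : B.repr (f (B (Fin.last m))) (Fin.last m) = 0
  · match m, B, hB, hc with
    | 0, B, hB, hc =>
      have h0 : f (B 0) = 0 := by
        rw [← B.sum_repr (f (B 0))]
        simp only [Fin.last, Fin.zero_eta] at hc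
        simp [hc]
      have : f = 0 := B.ext fun i => by
        rw [Fin.fin_one_eq_zero i, h0, LinearMap.zero_apply]
      exact ⟨0, top_unique fun x _ => mem_span_eigenvectors 0 (by simp), by simp [this]⟩
    | 1, B, hB, hc => exact isDiagAddNilpotent_of_cyclic_two h2 hcen B hB hc
    | m + 2, B, hB, hc => exact isDiagAddNilpotent_of_cyclic_of_eq_zero h2 B hB hc
  · exact isDiagAddNilpotent_of_cyclic_of_ne_zero B hB hc

theorem linearIndependent_pow_apply {f : End D V} {v : V} (n : ℕ)
    (h : ∀ m < n, (f ^ m) v ∉ span D (Set.range fun i : Fin m => (f ^ (i : ℕ)) v)) :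
    LinearIndependent D fun i : Fin n => (f ^ (i : ℕ)) v := by
  induction n with
  | zero => exact linearIndependent_empty_type
  | succ n ih =>
    have := linearIndependent_finSnoc.2 ⟨ih fun m hm => h m (by omega), h n (by omega)⟩
    convert this using 1
    ext i
    refine Fin.lastCases ?_ (fun j => ?_) i <;> simp

/-- Every nonzero vector generates a cyclic subspace with a basis of iterates. -/
theorem exists_cyclic_subspace [FiniteDimensional D V] (f : End D V) {v : V} (hv : v ≠ 0) :
    ∃ n : ℕ, LinearIndependent D (fun i : Fin (n + 1) => (f ^ (i : ℕ)) v) ∧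
      ∀ x ∈ span D (Set.range fun i : Fin (n + 1) => (f ^ (i : ℕ)) v),
        f x ∈ span D (Set.range fun i : Fin (n + 1) => (f ^ (i : ℕ)) v) := by
  classical
  have hex : ∃ n : ℕ, (f ^ n) v ∈ span D (Set.range fun i : Fin n => (f ^ (i : ℕ)) v) := by
    by_contra! hcon
    have := (linearIndependent_pow_apply (finrank D V + 1)
      fun m _ => hcon m).fintype_card_le_finrank
    simp at this
  obtain ⟨n, hn⟩ : ∃ n, Nat.find hex = n + 1 := by
    refine Nat.exists_eq_succ_of_ne_zero fun h0 => hv ?_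
    have := Nat.find_spec hex
    rw [h0] at this
    simpa [Set.range_eq_empty] using this
  refine ⟨n, linearIndependent_pow_apply _ fun m hm => Nat.find_min hex (hn ▸ hm), ?_⟩
  have hspec := Nat.find_spec hex
  rw [hn] at hspec
  suffices h : span D (Set.range fun i : Fin (n + 1) => (f ^ (i : ℕ)) v) ≤
      (span D (Set.range fun i : Fin (n + 1) => (f ^ (i : ℕ)) v)).comap f from fun x hx => h hx
  rw [span_le]
  rintro _ ⟨i, rfl⟩
  rw [SetLike.mem_coe, mem_comap, ← Module.End.mul_apply, ← pow_succ']
  rcases (Nat.succ_le_of_lt i.2).eq_or_lt with h | h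
  · rw [Nat.succ_eq_add_one] at h
    rwa [h]
  · exact subset_span ⟨⟨i + 1, h⟩, rfl⟩

end

theorem isDiagAddNilpotent_of_finiteDimensional {D : Type*} [DivisionRing D] (h2 : (2 : D) = 0)
    (hcen : ∀ c : D, (∀ x, x * c = c * x) → c = 0 ∨ c = 1) (n : ℕ) (V : Type u)
    [AddCommGroup V] [Module D V] [FiniteDimensional D V] (hn : finrank D V = n) (f : End D V) :
    IsDiagAddNilpotent f := by
  induction n using Nat.strong_induction_on generalizing V with
  | _ n ih =>
    rcases subsingleton_or_nontrivial V with hV | hV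
    · exact ⟨0, Subsingleton.elim _ _, Subsingleton.elim (0 : End D V) (f - 0) ▸ IsNilpotent.zero⟩
    obtain ⟨v, hv⟩ := exists_ne (0 : V)
    obtain ⟨m, hli, hinv⟩ := exists_cyclic_subspace f hv
    set W := span D (Set.range fun i : Fin (m + 1) => (f ^ (i : ℕ)) v) with hWdef
    obtain ⟨U, hU⟩ := W.exists_isCompl
    have hvW : v ∈ W := subset_span ⟨0, by simp⟩
    refine IsDiagAddNilpotent.of_isCompl hU hinv ?_ ?_
    · refine isDiagAddNilpotent_of_cyclic h2 hcen (Basis.span hli) (v := ⟨v, hvW⟩) fun i => ?_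
      apply Subtype.ext
      rw [Basis.span_apply, Module.End.pow_restrict]
      rfl
    · refine ih (finrank D U) ?_ U rfl _
      have hW : 0 < finrank D W := by
        have : Nontrivial W := ⟨⟨v, hvW⟩, 0, fun h => hv (congrArg Subtype.val h)⟩
        exact finrank_pos
      have := finrank_add_eq_of_isCompl hU
      omega

theorem isDiagonalizable_of_eigenvectorsSpan {D : Type*} [DivisionRing D] {n : ℕ}
    {G : Matrix (Fin n) (Fin n) D} (h : EigenvectorsSpan (Matrix.toLinearMapRight' G)) :
    IsDiagonalizable G := by
  obtain ⟨b, hb⟩ : ∃ b : Basis (Fin n) D (Fin n → D),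
      ∀ i, ∃ a : D, Matrix.toLinearMapRight' G (b i) = a • b i := by
    let b₀ := Basis.ofSpan h.ge
    have hfin : Finite _ := Module.Finite.finite_basis b₀
    have hcard := Module.finrank_eq_nat_card_basis b₀
    rw [finrank_fin_fun] at hcard
    let e := Finite.equivFinOfCardEq hcard.symm
    refine ⟨b₀.reindex e, fun i => ?_⟩
    rw [Basis.reindex_apply]
    exact Basis.ofSpan_subset h.ge ⟨_, rfl⟩
  choose d hd using hb
  set S : Matrix (Fin n) (Fin n) D := Matrix.of fun i => b i with hS
  set T : Matrix (Fin n) (Fin n) D := Matrix.of fun i => b.repr (Pi.single i 1) with hT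
  have hTS : T * S = 1 := by
    ext i j
    have := congrFun (b.sum_repr (Pi.single i 1)) j
    rw [Finset.sum_apply] at this
    simpa [Matrix.mul_apply, hS, hT, Matrix.one_apply, Pi.single_apply, eq_comm] using this
  have hST : S * T = 1 := mul_eq_one_comm.1 hTS
  refine ⟨T, S, hTS, hST, d, ?_⟩
  have hSG : S * G = Matrix.diagonal d * S := by
    ext i j
    have := congrFun (hd i) j
    rw [Matrix.toLinearMapRight'_apply] at this
    rw [Matrix.diagonal_mul]
    exact this
  rw [hSG, Matrix.mul_assoc, hST, Matrix.mul_one]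

/-- If the center of a division ring D is the field with two elements, every
    n×n matrix over D is a sum of three diagonalizable matrices. -/
theorem stmt_8 (D : Type*) [DivisionRing D]
    (hcenter : Nat.card (Subring.center D) = 2)
    {n : ℕ} (hn : 0 < n) (A : Matrix (Fin n) (Fin n) D) :
    ∃ B C E : Matrix (Fin n) (Fin n) D,
      IsDiagonalizable B ∧ IsDiagonalizable C ∧ IsDiagonalizable E ∧
      A = B + C + E := by
  have hcen' : ∀ c : Subring.center D, c = 0 ∨ c = 1 := by
    obtain ⟨y, -, hy⟩ := (Nat.card_eq_two_iff' (0 : Subring.center D)).1 hcenter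
    intro c
    by_cases hc : c = 0
    · exact Or.inl hc
    · exact Or.inr ((hy c hc).trans (hy 1 one_ne_zero).symm)
  have hcen : ∀ c : D, (∀ x, x * c = c * x) → c = 0 ∨ c = 1 := fun c hc =>
    (hcen' ⟨c, Subring.mem_center_iff.2 hc⟩).imp (congrArg Subtype.val) (congrArg Subtype.val)
  have h2 : (2 : D) = 0 := by
    refine (hcen 2 fun x => by rw [mul_two, two_mul]).resolve_right fun h => one_ne_zero (α := D) ?_
    rwa [← one_add_one_eq_two, add_eq_left] at h
  obtain ⟨g, hg, hN⟩ := isDiagAddNilpotent_of_finiteDimensional h2 hcen _ (Fin n → D) rfl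
    (Matrix.toLinearMapRight' A)
  obtain ⟨p, q, hp, hq, hpq⟩ := exists_eq_sub_of_isNilpotent hN
  refine ⟨LinearMap.toMatrixRight' g, LinearMap.toMatrixRight' p, LinearMap.toMatrixRight' (-q),
    isDiagonalizable_of_eigenvectorsSpan (by simpa using hg),
    isDiagonalizable_of_eigenvectorsSpan (by simpa using hp),
    isDiagonalizable_of_eigenvectorsSpan (by simpa using hq.neg), ?_⟩
  rw [← map_add, ← map_add, add_assoc, ← sub_eq_add_neg, ← hpq, add_sub_cancel]
  simp
end

section
/- Let D be a division ring of characteristic different from 2 which is not the field with three elements, and let n be a positive integer. Then every n×n matrix over D can be written as a product of two diagonalizable matrices over D. -/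
/-- The span of the eigenvectors of an endomorphism of a left vector space over a division ring. -/
def eigenvectorSpan {D V : Type*} [DivisionRing D] [AddCommGroup V] [Module D V]
    (h : V →ₗ[D] V) : Submodule D V :=
  Submodule.span D {x | ∃ c : D, h x = c • x}

section EigenvectorSpan

variable {D V W : Type*} [DivisionRing D] [AddCommGroup V] [Module D V]
  [AddCommGroup W] [Module D W]

theorem mem_eigenvectorSpan_of_eq_smul {h : V →ₗ[D] V} {x : V} {c : D} (hx : h x = c • x) :
    x ∈ eigenvectorSpan h :=
  Submodule.subset_span ⟨c, hx⟩

theorem mem_eigenvectorSpan_of_swap {h : V →ₗ[D] V} (h2 : (2 : D) ≠ 0) {x y : V}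
    (hx : h x = y) (hy : h y = x) : x ∈ eigenvectorSpan h := by
  have hp : x + y ∈ eigenvectorSpan h :=
    mem_eigenvectorSpan_of_eq_smul (c := 1) (by rw [map_add, hx, hy, one_smul, add_comm])
  have hm : x - y ∈ eigenvectorSpan h :=
    mem_eigenvectorSpan_of_eq_smul (c := -1) (by rw [map_sub, hx, hy]; simp)
  have h2x : x = (2⁻¹ : D) • ((x + y) + (x - y)) := by
    rw [show (x + y) + (x - y) = (2 : D) • x by rw [two_smul]; abel, smul_smul,
      inv_mul_cancel₀ h2, one_smul]
  rw [h2x]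
  exact Submodule.smul_mem _ _ (add_mem hp hm)

/-- If `h` is an involution on an invariant subspace `H` and acts on `V ⧸ H ∋ v` by a scalar `c`
different from `±1`, then `v` lies in the span of the eigenvectors of `h`. -/
theorem mem_eigenvectorSpan_of_apply_eq_smul_add {h : V →ₗ[D] V} (h2 : (2 : D) ≠ 0) {v w : V}
    {c : D} (hv : h v = c • v + w) (hw : h (h w) = w) (hc₁ : c ≠ 1) (hc₂ : c ≠ -1) :
    v ∈ eigenvectorSpan h := by
  have hw₁ : w ∈ eigenvectorSpan h := mem_eigenvectorSpan_of_swap h2 rfl hw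
  have hw₂ : h w ∈ eigenvectorSpan h := mem_eigenvectorSpan_of_swap h2 hw rfl
  have hc₁' : c - 1 ≠ 0 := sub_ne_zero.2 hc₁
  have hc₂' : c + 1 ≠ 0 := fun h0 => hc₂ (eq_neg_of_add_eq_zero_left h0)
  set p : V := (2⁻¹ : D) • (w + h w) with hp
  set q : V := (2⁻¹ : D) • (w - h w) with hq
  have hhp : h p = p := by rw [hp, map_smul, map_add, hw, add_comm]
  have hhq : h q = -q := by rw [hq, map_smul, map_sub, hw, ← smul_neg, neg_sub]
  have hpq : p + q = w := by
    rw [hp, hq, ← smul_add, show w + h w + (w - h w) = (2 : D) • w by rw [two_smul]; abel,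
      smul_smul, inv_mul_cancel₀ h2, one_smul]
  set y : V := (c - 1)⁻¹ • p + (c + 1)⁻¹ • q with hy
  have hymem : y ∈ eigenvectorSpan h :=
    add_mem (Submodule.smul_mem _ _ (Submodule.smul_mem _ _ (add_mem hw₁ hw₂)))
      (Submodule.smul_mem _ _ (Submodule.smul_mem _ _ (sub_mem hw₁ hw₂)))
  have hcy : c • y - h y = w := by
    have e : c • y - h y = ((c - 1) * (c - 1)⁻¹) • p + ((c + 1) * (c + 1)⁻¹) • q := by
      rw [hy, map_add, map_smul _ _ p, map_smul _ _ q, hhp, hhq]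
      simp only [add_mul, sub_mul, add_smul, sub_smul, smul_add, mul_smul, one_smul, smul_neg]
      abel
    rw [e, mul_inv_cancel₀ hc₁', mul_inv_cancel₀ hc₂', one_smul, one_smul, hpq]
  have hvy : v + y ∈ eigenvectorSpan h := by
    refine mem_eigenvectorSpan_of_eq_smul (c := c) ?_
    rw [map_add, hv, smul_add, ← hcy]
    abel
  simpa using sub_mem hvy hymem

theorem eigenvectorSpan_prodMap_eq_top {g : V →ₗ[D] V} {h : W →ₗ[D] W}
    (hg : eigenvectorSpan g = ⊤) (hh : eigenvectorSpan h = ⊤) :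
    eigenvectorSpan (g.prodMap h) = ⊤ := by
  have h₁ : eigenvectorSpan g ≤ (eigenvectorSpan (g.prodMap h)).comap (LinearMap.inl D V W) := by
    refine Submodule.span_le.2 ?_
    rintro x ⟨c, hx⟩
    exact mem_eigenvectorSpan_of_eq_smul (c := c) (by simp [hx])
  have h₂ : eigenvectorSpan h ≤ (eigenvectorSpan (g.prodMap h)).comap (LinearMap.inr D V W) := by
    refine Submodule.span_le.2 ?_
    rintro x ⟨c, hx⟩
    exact mem_eigenvectorSpan_of_eq_smul (c := c) (by simp [hx])
  rw [eq_top_iff]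
  rintro ⟨x, y⟩ -
  have hx : x ∈ eigenvectorSpan g := hg ▸ Submodule.mem_top
  have hy : y ∈ eigenvectorSpan h := hh ▸ Submodule.mem_top
  have hxy := add_mem (Submodule.mem_comap.1 (h₁ hx)) (Submodule.mem_comap.1 (h₂ hy))
  simpa using hxy

theorem eigenvectorSpan_conj_eq_top {g : V →ₗ[D] V} (e : V ≃ₗ[D] W)
    (hg : eigenvectorSpan g = ⊤) :
    eigenvectorSpan (e.toLinearMap ∘ₗ g ∘ₗ e.symm.toLinearMap) = ⊤ := by
  have h₁ : eigenvectorSpan g ≤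
      (eigenvectorSpan (e.toLinearMap ∘ₗ g ∘ₗ e.symm.toLinearMap)).comap e.toLinearMap := by
    refine Submodule.span_le.2 ?_
    rintro x ⟨c, hx⟩
    exact mem_eigenvectorSpan_of_eq_smul (c := c) (by simp [hx])
  rw [eq_top_iff]
  intro y _
  have hy : e.symm y ∈ eigenvectorSpan g := hg ▸ Submodule.mem_top
  simpa using h₁ hy

theorem eigenvectorSpan_id : eigenvectorSpan (LinearMap.id : V →ₗ[D] V) = ⊤ :=
  eq_top_iff.2 fun x _ => mem_eigenvectorSpan_of_eq_smul (c := 1) (by simp)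

theorem eigenvectorSpan_eq_top_of_basis {ι : Type*} (b : Module.Basis ι D V) {h : V →ₗ[D] V}
    (hb : ∀ i, b i ∈ eigenvectorSpan h) : eigenvectorSpan h = ⊤ := by
  rw [eq_top_iff, ← b.span_eq]
  refine Submodule.span_le.2 ?_
  rintro _ ⟨i, rfl⟩
  exact hb i

end EigenvectorSpan

theorem exists_ne_zero_ne_neg_one_ne_ne_neg {D : Type*} [DivisionRing D] (h2 : (2 : D) ≠ 0)
    (hD : Nat.card D ≠ 3) (z : D) : ∃ β : D, β ≠ 0 ∧ β ≠ -1 ∧ β ≠ z ∧ β ≠ -z := by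
  by_contra! H
  have h11 : (1 : D) ≠ -1 := fun h =>
    h2 (by rw [← one_add_one_eq_two]; exact add_eq_zero_iff_eq_neg.2 h)
  have key : ∀ β : D, β ≠ 0 → β ≠ -1 → β = 1 := by
    have h1 : (1 : D) = z ∨ (1 : D) = -z := by
      by_contra! h
      exact h.2 (H 1 one_ne_zero h11 h.1)
    intro β h0 hm
    rcases h1 with h | h
    · rw [← h] at H
      by_contra h'
      exact hm (H β h0 hm h')
    · obtain rfl : z = -1 := by rw [h, neg_neg]
      simpa using H β h0 hm hm
  apply hD
  classical
  have hs : (Set.univ : Set D) = (({0, 1, -1} : Finset D) : Set D) := by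
    ext x
    have := key x
    simp only [Set.mem_univ, Finset.coe_insert, Finset.coe_singleton, Set.mem_insert_iff,
      Set.mem_singleton_iff, true_iff]
    tauto
  rw [← Set.ncard_univ, hs, Set.ncard_coe_finset, Finset.card_eq_three]
  exact ⟨0, 1, -1, zero_ne_one, (neg_ne_zero.2 one_ne_zero).symm, h11, rfl⟩

section Factorization

variable {D : Type*} [DivisionRing D]

/-- An endomorphism acting as a shift on a basis, except on the last basis vector, is a product of
two diagonalizable endomorphisms. -/
theorem exists_comp_of_basis_shift {V : Type*} [AddCommGroup V] [Module D V] (h2 : (2 : D) ≠ 0)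
    (hD : Nat.card D ≠ 3) {k : ℕ} (b : Module.Basis (Fin (k + 1)) D V) (f : V →ₗ[D] V)
    (hf : ∀ i : Fin k, f (b i.castSucc) = b i.succ) :
    ∃ g h : V →ₗ[D] V, eigenvectorSpan g = ⊤ ∧ eigenvectorSpan h = ⊤ ∧ f = g ∘ₗ h := by
  cases k with
  | zero =>
    refine ⟨LinearMap.id, f, eigenvectorSpan_id, ?_, rfl⟩
    refine eigenvectorSpan_eq_top_of_basis b fun i => ?_
    refine mem_eigenvectorSpan_of_eq_smul (c := b.repr (f (b i)) i) ?_
    conv_lhs => rw [← b.sum_repr (f (b i))]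
    rw [Fin.sum_univ_one, Subsingleton.elim (0 : Fin 1) i]
  | succ k =>
    obtain ⟨β, hβ0, hβ1, hβz, hβz'⟩ := exists_ne_zero_ne_neg_one_ne_ne_neg h2 hD
      (b.repr (f (b (Fin.last (k + 1)))) 0)
    set l := Fin.last (k + 1) with hl
    obtain ⟨g, hg, hgl⟩ : ∃ g : V →ₗ[D] V,
        (∀ i : Fin (k + 1), g (b i.castSucc) = b i.rev.succ) ∧
          g (b l) = (1 - β) • b l + β • b 0 := by
      refine ⟨b.constr ℕ (Fin.lastCases ((1 - β) • b l + β • b 0) fun i => b i.rev.succ), ?_, ?_⟩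
      · intro i
        rw [Module.Basis.constr_basis, Fin.lastCases_castSucc]
      · rw [Module.Basis.constr_basis, Fin.lastCases_last]
    have hg0 : g (b 0) = b l := by
      have := hg 0
      rwa [Fin.castSucc_zero, Fin.rev_zero, Fin.succ_last] at this
    have hgmid : ∀ j : Fin k, g (b j.succ.castSucc) = b j.rev.succ.castSucc := by
      intro j
      rw [hg, Fin.rev_succ, Fin.succ_castSucc]
    have hgsurj : Function.Surjective g := by
      rw [← LinearMap.range_eq_top, eq_top_iff, ← b.span_eq]
      refine Submodule.span_le.2 ?_
      have hlmem : b l ∈ LinearMap.range g := ⟨_, hg0⟩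
      rintro _ ⟨i, rfl⟩
      induction i using Fin.cases with
      | zero =>
        have : b 0 = β⁻¹ • (g (b l) - (1 - β) • b l) := by
          rw [hgl, add_sub_cancel_left, smul_smul, inv_mul_cancel₀ hβ0, one_smul]
        rw [this]
        exact Submodule.smul_mem _ _ (sub_mem ⟨_, rfl⟩ (Submodule.smul_mem _ _ hlmem))
      | succ i => exact ⟨b i.rev.castSucc, by rw [hg, Fin.rev_rev]⟩
    obtain ⟨u, hu⟩ := hgsurj (f (b l))
    obtain ⟨h, hh, hhl⟩ : ∃ h : V →ₗ[D] V,
        (∀ i : Fin (k + 1), h (b i.castSucc) = b i.rev.castSucc) ∧ h (b l) = u := by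
      refine ⟨b.constr ℕ (Fin.lastCases u fun i => b i.rev.castSucc), ?_, ?_⟩
      · intro i
        rw [Module.Basis.constr_basis, Fin.lastCases_castSucc]
      · rw [Module.Basis.constr_basis, Fin.lastCases_last]
    have hcoord : b.repr (f (b l)) 0 = b.repr u l * β := by
      have hsum := b.sum_repr u
      rw [Fin.sum_univ_castSucc] at hsum
      rw [← hu]
      conv_lhs => rw [← hsum]
      rw [map_add, map_sum, map_smul, ← hl, hgl]
      simp [hg, Fin.succ_ne_zero, hl]
    refine ⟨g, h, ?_, ?_, ?_⟩
    · refine eigenvectorSpan_eq_top_of_basis b fun i => ?_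
      have e₁ : b l + β • b 0 ∈ eigenvectorSpan g := by
        refine mem_eigenvectorSpan_of_eq_smul (c := 1) ?_
        rw [map_add, map_smul, hgl, hg0, sub_smul, one_smul, one_smul]
        abel
      have e₂ : b l - b 0 ∈ eigenvectorSpan g := by
        refine mem_eigenvectorSpan_of_eq_smul (c := -β) ?_
        rw [map_sub, hgl, hg0, sub_smul, one_smul, smul_sub, neg_smul, neg_smul]
        abel
      have hβ1' : β + 1 ≠ 0 := fun h0 => hβ1 (eq_neg_of_add_eq_zero_left h0)
      have m0 : b 0 ∈ eigenvectorSpan g := by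
        have : b 0 = (β + 1)⁻¹ • ((b l + β • b 0) - (b l - b 0)) := by
          rw [show (b l + β • b 0) - (b l - b 0) = (β + 1) • b 0 by
              rw [add_smul, one_smul]; abel, smul_smul,
            inv_mul_cancel₀ hβ1', one_smul]
        rw [this]
        exact Submodule.smul_mem _ _ (sub_mem e₁ e₂)
      induction i using Fin.lastCases with
      | last => simpa using add_mem e₂ m0
      | cast i =>
        induction i using Fin.cases with
        | zero => simpa using m0
        | succ j =>
          exact mem_eigenvectorSpan_of_swap h2 (hgmid j) (by rw [hgmid, Fin.rev_rev])
    · have hhh : ∀ i : Fin (k + 1), h (h (b i.castSucc)) = b i.castSucc := by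
        intro i
        rw [hh, hh, Fin.rev_rev]
      refine eigenvectorSpan_eq_top_of_basis b fun i => ?_
      induction i using Fin.lastCases with
      | cast i => exact mem_eigenvectorSpan_of_swap h2 rfl (hhh i)
      | last =>
        have hsum := b.sum_repr u
        rw [Fin.sum_univ_castSucc] at hsum
        refine mem_eigenvectorSpan_of_apply_eq_smul_add h2 (c := b.repr u l)
          (w := ∑ i : Fin (k + 1), b.repr u i.castSucc • b i.castSucc) ?_ ?_ ?_ ?_
        · rw [hhl, add_comm, hsum]
        · simp only [map_sum, map_smul, hhh]
        · intro hc
          rw [hc, one_mul] at hcoord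
          exact hβz hcoord.symm
        · intro hc
          rw [hc, neg_one_mul] at hcoord
          exact hβz' (by rw [hcoord, neg_neg])
    · refine b.ext fun i => ?_
      induction i using Fin.lastCases with
      | cast i => rw [LinearMap.comp_apply, hh, hg, Fin.rev_rev, hf]
      | last => rw [LinearMap.comp_apply, hhl, hu]

/-- A nontrivial finite-dimensional space with an endomorphism splits off an invariant cyclic
subspace. -/
theorem exists_isCompl_cyclic {V : Type*} [AddCommGroup V] [Module D V] [FiniteDimensional D V]
    [Nontrivial V] (f : V →ₗ[D] V) :
    ∃ (k : ℕ) (Z K : Submodule D V) (b : Module.Basis (Fin (k + 1)) D Z), IsCompl Z K ∧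
      (∀ x ∈ Z, f x ∈ Z) ∧ (∀ x ∈ K, f x ∈ K) ∧
        ∀ i : Fin k, f (b i.castSucc) = b i.succ := by
  classical
  let P : ℕ → Prop := fun k => ∃ (v : V) (φ : V →ₗ[D] D),
    (∀ i < k, φ ((f ^ i) v) = 0) ∧ φ ((f ^ k) v) = 1
  have hPscale : ∀ (k : ℕ) (v : V) (φ : V →ₗ[D] D), (∀ i < k, φ ((f ^ i) v) = 0) →
      φ ((f ^ k) v) ≠ 0 → P k := by
    intro k v φ h0 h1
    refine ⟨(φ ((f ^ k) v))⁻¹ • v, φ, fun i hi => ?_, ?_⟩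
    · rw [map_smul, map_smul, h0 i hi, smul_zero]
    · rw [map_smul, map_smul, smul_eq_mul, inv_mul_cancel₀ h1]
  have hP0 : P 0 := by
    obtain ⟨v, hv⟩ := exists_ne (0 : V)
    obtain ⟨φ, hφ, -⟩ := Submodule.exists_le_ker_of_notMem (K := D) (p := (⊥ : Submodule D V))
      (v := v) (by simpa using hv)
    exact hPscale 0 v φ (by simp) (by simpa using hφ)
  let Ψ : (k : ℕ) → V → ((Fin (k + 1) → D) →ₗ[D] V) := fun k v =>
    Fintype.linearCombination D fun i : Fin (k + 1) => (f ^ (i : ℕ)) v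
  let Φ : (k : ℕ) → (V →ₗ[D] D) → (V →ₗ[D] (Fin (k + 1) → D)) := fun k φ =>
    LinearMap.pi fun i : Fin (k + 1) => φ ∘ₗ (f ^ (i : ℕ))
  have hinj : ∀ (k : ℕ) (v : V) (φ : V →ₗ[D] D), (∀ i < k, φ ((f ^ i) v) = 0) →
      φ ((f ^ k) v) = 1 → Function.Injective (Φ k φ ∘ₗ Ψ k v) := by
    intro k v φ h0 h1
    rw [← LinearMap.ker_eq_bot, LinearMap.ker_eq_bot']
    intro c hc
    have hc' : ∀ i : Fin (k + 1), ∑ j : Fin (k + 1), c j * φ ((f ^ ((i : ℕ) + j)) v) = 0 := by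
      intro i
      have := congrFun hc i
      simpa [Φ, Ψ, Fintype.linearCombination_apply, pow_add] using this
    have main : ∀ m : ℕ, ∀ i : Fin (k + 1), (i : ℕ) + m = k → c i = 0 := by
      intro m
      induction m using Nat.strong_induction_on with
      | _ m ih =>
        intro i him
        have := hc' ⟨m, by omega⟩
        rw [Finset.sum_eq_single i] at this
        · simpa [show m + (i : ℕ) = k by omega, h1] using this
        · intro j _ hji
          rcases lt_or_gt_of_ne (fun h => hji (Fin.ext h) : (j : ℕ) ≠ i) with hlt | hgt
          · rw [h0 _ (by simp only; omega), mul_zero]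
          · rw [ih (k - j) (by omega) j (by omega), zero_mul]
        · simp
    funext i
    exact main (k - i) i (by omega)
  have hbound : ∀ k, P k → k < Module.finrank D V := by
    rintro k ⟨v, φ, h0, h1⟩
    have := hinj k v φ h0 h1
    rw [LinearMap.coe_comp] at this
    simpa using LinearMap.finrank_le_finrank_of_injective this.of_comp
  obtain ⟨k, ⟨v, φ, h0, h1⟩, hmax⟩ : ∃ k, P k ∧ ¬ P (k + 1) := by
    by_contra! H
    have : ∀ k, P k := fun k => Nat.rec hP0 (fun k hk => H k hk) k
    exact lt_irrefl _ (hbound _ (this _))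
  have hΦΨ := hinj k v φ h0 h1
  have hΨ : Function.Injective (Ψ k v) := by
    rw [LinearMap.coe_comp] at hΦΨ
    exact hΦΨ.of_comp
  have hΨsingle : ∀ i : Fin (k + 1), Ψ k v (Pi.single i 1) = (f ^ (i : ℕ)) v := by
    intro i
    simp [Ψ, Fintype.linearCombination_apply_single]
  have hmemΨ : ∀ i < k + 1, (f ^ i) v ∈ LinearMap.range (Ψ k v) := fun i hi =>
    ⟨Pi.single ⟨i, hi⟩ 1, hΨsingle ⟨i, hi⟩⟩
  let b : Module.Basis (Fin (k + 1)) D (LinearMap.range (Ψ k v)) :=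
    Module.Basis.ofEquivFun (LinearEquiv.ofInjective (Ψ k v) hΨ).symm
  have hb : ∀ i, (b i : V) = (f ^ (i : ℕ)) v := by
    intro i
    rw [← hΨsingle]
    simp [b]
  refine ⟨k, LinearMap.range (Ψ k v), LinearMap.ker (Φ k φ), b, ⟨?_, ?_⟩, ?_, ?_, ?_⟩
  · rw [Submodule.disjoint_def]
    rintro _ ⟨c, rfl⟩ hx
    have : c = 0 := hΦΨ (by simpa using hx)
    rw [this, map_zero]
  · rw [codisjoint_iff, eq_top_iff]
    intro x _
    obtain ⟨c, hc⟩ := LinearMap.injective_iff_surjective.1 hΦΨ (Φ k φ x)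
    rw [← add_sub_cancel (Ψ k v c) x]
    refine Submodule.add_mem_sup ⟨c, rfl⟩ ?_
    rw [LinearMap.mem_ker, map_sub, ← hc, LinearMap.comp_apply, sub_self]
  · have hlast : (f ^ (k + 1)) v ∈ LinearMap.range (Ψ k v) := by
      by_contra hn
      obtain ⟨ψ, hψ, hker⟩ := Submodule.exists_le_ker_of_notMem hn
      exact hmax (hPscale (k + 1) v ψ (fun i hi => hker (hmemΨ i hi)) hψ)
    rintro _ ⟨c, rfl⟩
    simp only [Ψ, Fintype.linearCombination_apply, map_sum, map_smul]
    refine sum_mem fun i _ => Submodule.smul_mem _ _ ?_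
    rw [← Module.End.mul_apply, ← pow_succ']
    rcases Nat.lt_or_ge ((i : ℕ) + 1) (k + 1) with hi | hi
    · exact hmemΨ _ hi
    · rwa [show (i : ℕ) + 1 = k + 1 by omega]
  · intro x hx
    have hx' : ∀ i < k + 1, φ ((f ^ i) x) = 0 := fun i hi => by
      simpa [Φ] using congrFun (LinearMap.mem_ker.1 hx) ⟨i, hi⟩
    have hlast : φ ((f ^ (k + 1)) x) = 0 := by
      by_contra hn
      exact hmax (hPscale (k + 1) x φ hx' hn)
    rw [LinearMap.mem_ker]
    funext i
    change φ ((f ^ (i : ℕ)) (f x)) = 0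
    rw [← Module.End.mul_apply, ← pow_succ]
    rcases Nat.lt_or_ge ((i : ℕ) + 1) (k + 1) with hi | hi
    · exact hx' _ hi
    · rwa [show (i : ℕ) + 1 = k + 1 by omega]
  · intro i
    rw [hb, hb, ← Module.End.mul_apply, ← pow_succ']
    simp

/-- Every endomorphism of a finite-dimensional space over a division ring of characteristic not
two, other than the field with three elements, is a product of two diagonalizable ones. -/
theorem exists_comp_of_finiteDimensional.{u} (h2 : (2 : D) ≠ 0) (hD : Nat.card D ≠ 3) (n : ℕ) :
    ∀ (V : Type u) [AddCommGroup V] [Module D V] [FiniteDimensional D V],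
      Module.finrank D V = n → ∀ f : V →ₗ[D] V,
        ∃ g h : V →ₗ[D] V, eigenvectorSpan g = ⊤ ∧ eigenvectorSpan h = ⊤ ∧ f = g ∘ₗ h := by
  induction n using Nat.strong_induction_on with
  | _ n ih =>
    intro V _ _ _ hn f
    rcases subsingleton_or_nontrivial V with hV | hV
    · exact ⟨LinearMap.id, f, eigenvectorSpan_id, Subsingleton.elim _ _, rfl⟩
    obtain ⟨k, Z, K, b, hZK, hZ, hK, hb⟩ := exists_isCompl_cyclic f
    obtain ⟨g₁, h₁, hg₁, hh₁, hf₁⟩ := exists_comp_of_basis_shift h2 hD b (f.restrict hZ)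
      fun i => Subtype.ext (hb i)
    have hlt : Module.finrank D K < n := by
      have h₁ := Submodule.finrank_add_eq_of_isCompl hZK
      have h₂ := Module.finrank_eq_card_basis b
      rw [Fintype.card_fin] at h₂
      omega
    obtain ⟨g₂, h₂, hg₂, hh₂, hf₂⟩ := ih _ hlt K rfl (f.restrict hK)
    let e := Submodule.prodEquivOfIsCompl Z K hZK
    refine ⟨e.toLinearMap ∘ₗ (g₁.prodMap g₂) ∘ₗ e.symm.toLinearMap,
      e.toLinearMap ∘ₗ (h₁.prodMap h₂) ∘ₗ e.symm.toLinearMap,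
      eigenvectorSpan_conj_eq_top e (eigenvectorSpan_prodMap_eq_top hg₁ hg₂),
      eigenvectorSpan_conj_eq_top e (eigenvectorSpan_prodMap_eq_top hh₁ hh₂), ?_⟩
    refine LinearMap.ext fun x => ?_
    obtain ⟨⟨y, z⟩, rfl⟩ := e.surjective x
    have hy : (g₁ (h₁ y) : V) = f y := by
      rw [← LinearMap.comp_apply, ← hf₁, LinearMap.coe_restrict_apply]
    have hz : (g₂ (h₂ z) : V) = f z := by
      rw [← LinearMap.comp_apply, ← hf₂, LinearMap.coe_restrict_apply]
    simp [e, hy, hz]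

end Factorization

theorem isDiagonalizable_toMatrixRight' {D : Type*} [DivisionRing D] {n : ℕ}
    {h : (Fin n → D) →ₗ[D] (Fin n → D)} (hh : eigenvectorSpan h = ⊤) :
    IsDiagonalizable (LinearMap.toMatrixRight' h) := by
  let b₀ := Module.Basis.ofSpan (K := D) (V := Fin n → D) (ge_of_eq hh)
  let b := b₀.reindex (b₀.indexEquiv (Pi.basisFun D (Fin n)))
  have hb : ∀ i, ∃ c : D, h (b i) = c • b i := by
    intro i
    rw [Module.Basis.reindex_apply]
    exact Module.Basis.ofSpan_subset (ge_of_eq hh) ⟨_, rfl⟩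
  choose d hd using hb
  refine ⟨LinearMap.toMatrixRight' b.equivFun.toLinearMap,
    LinearMap.toMatrixRight' b.equivFun.symm.toLinearMap, ?_, ?_, d, ?_⟩
  · rw [← LinearMap.toMatrixRight'_comp]
    simp
  · rw [← LinearMap.toMatrixRight'_comp]
    simp
  · rw [← LinearMap.toMatrixRight'_comp, ← LinearMap.toMatrixRight'_comp]
    apply Matrix.toLinearMapRight'.injective
    refine (Pi.basisFun D (Fin n)).ext fun i => ?_
    simp [hd, Finsupp.single_eq_pi_single, ← Pi.single_smul]

/-- Over a division ring of characteristic ≠ 2 that is not the field with three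
    elements, every n×n matrix is a product of two diagonalizable matrices. -/
theorem stmt_12 (D : Type*) [DivisionRing D] (hchar : ringChar D ≠ 2)
    (hD : Nat.card D ≠ 3)
    {n : ℕ} (hn : 0 < n) (A : Matrix (Fin n) (Fin n) D) :
    ∃ B C : Matrix (Fin n) (Fin n) D,
      IsDiagonalizable B ∧ IsDiagonalizable C ∧ A = B * C := by
  obtain ⟨g, h, hg, hh, hf⟩ := exists_comp_of_finiteDimensional (Ring.two_ne_zero hchar) hD _
    (Fin n → D) rfl (Matrix.toLinearMapRight' A)
  refine ⟨_, _, isDiagonalizable_toMatrixRight' hh, isDiagonalizable_toMatrixRight' hg, ?_⟩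
  rw [← LinearMap.toMatrixRight'_comp, ← hf, LinearEquiv.apply_symm_apply]
end

section
/- Let D be a noncommutative division ring of characteristic 2 containing at least four elements, and let n be a positive integer. Then every n×n matrix over D can be written as a product of four diagonalizable matrices over D. -/
open Polynomial in
/-- If a product of factors `X - c`, evaluated at `f`, kills a nonzero vector, then some `c` is
an eigenvalue of `f`. -/
theorem exists_mul_eq_mul_of_prod_aeval {R : Type*} [CommRing R] {M : Type*} [AddCommGroup M]
    [Module R M] (f : Module.End R M) (s : Finset R) (z : M) (hz : z ≠ 0)
    (h : aeval f (∏ c ∈ s, (X - C c)) z = 0) : ∃ c ∈ s, ∃ w : M, w ≠ 0 ∧ f w = c • w := by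
  classical
  induction s using Finset.induction_on generalizing z with
  | empty => simp [hz] at h
  | insert c s hc ih =>
    rw [Finset.prod_insert hc, mul_comm, map_mul, Module.End.mul_apply] at h
    by_cases h0 : aeval f (X - C c) z = 0
    · refine ⟨c, by simp, z, hz, ?_⟩
      simpa [sub_eq_zero] using h0
    · obtain ⟨d, hd, hw⟩ := ih _ h0 h
      exact ⟨d, by simp [hd], hw⟩

theorem exists_mul_eq_pow_mul {D : Type*} [DivisionRing D] [CharP D 2] (a b : D)
    (hab : a * b ≠ b * a) (ha : 0 < orderOf a) :
    ∃ w : D, w ≠ 0 ∧ w * a ≠ a * w ∧ ∃ j : ℕ, w * a = a ^ j * w := by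
  classical
  let := ZMod.algebra D 2
  let K := Algebra.adjoin (ZMod 2) ({a} : Set D)
  have : IsMulCommutative K := Algebra.isMulCommutative_adjoin (ZMod 2)
    (by intro x hx y hy; simp_all)
  let ζ : K := ⟨a, Algebra.subset_adjoin (by simp)⟩
  have hord : orderOf ζ = orderOf a := by
    rw [← orderOf_injective (K.val : K →* D) Subtype.val_injective ζ]; rfl
  have hprim : IsPrimitiveRoot ζ (orderOf a) := hord ▸ IsPrimitiveRoot.orderOf ζ
  let f : Module.End K D :=
    { toFun := fun d => d * a
      map_add' := fun x y => add_mul x y a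
      map_smul' := fun c x => mul_assoc (c : D) x a }
  have hf : ∀ k x, (f ^ k) x = x * a ^ k := by
    intro k
    induction k with
    | zero => intro x; simp
    | succ k ih =>
      intro x
      rw [pow_succ, Module.End.mul_apply, ih, pow_succ', ← mul_assoc]; rfl
  have hprod := Polynomial.X_pow_sub_one_eq_prod ha hprim
  have hmem : ζ ∈ Polynomial.nthRootsFinset (orderOf a) (1 : K) := by
    rw [Polynomial.mem_nthRootsFinset ha]; exact hprim.pow_eq_one
  rw [← Finset.prod_erase_mul _ _ hmem] at hprod
  have key : Polynomial.aeval f (∏ c ∈ (Polynomial.nthRootsFinset (orderOf a) (1 : K)).erase ζ,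
      (Polynomial.X - Polynomial.C c)) (Polynomial.aeval f (Polynomial.X - Polynomial.C ζ) b) = 0 := by
    rw [← Module.End.mul_apply, ← map_mul, ← hprod]
    simp [hf, pow_orderOf_eq_one]
  obtain ⟨c, hc, w, hw, hcw⟩ := exists_mul_eq_mul_of_prod_aeval f _ _ (by
    intro h0
    apply hab
    have : b * a - a * b = 0 := by
      rw [← h0, map_sub, Polynomial.aeval_X, Polynomial.aeval_C]; rfl
    exact (sub_eq_zero.1 this).symm) key
  rw [Finset.mem_erase, Polynomial.mem_nthRootsFinset ha] at hc
  have : NeZero (orderOf a) := ⟨ha.ne'⟩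
  obtain ⟨j, -, hj⟩ := hprim.eq_pow_of_pow_eq_one hc.2
  have hcw' : w * a = (c : D) * w := hcw
  refine ⟨w, hw, fun h => hc.1 (Subtype.ext ?_), j, ?_⟩
  · exact (mul_right_cancel₀ hw (h.symm.trans hcw')).symm
  · rw [hcw', ← hj]; rfl

theorem commute_of_mul_eq_pow_mul {D : Type*} [DivisionRing D] [CharP D 2] {a w : D}
    (ha : 0 < orderOf a) (hw : 0 < orderOf w) {j : ℕ} (h : w * a = a ^ j * w) :
    w * a = a * w := by
  let := ZMod.algebra D 2
  have h1 : ∀ k, w * a ^ k = a ^ (j * k) * w := by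
    intro k
    induction k with
    | zero => simp
    | succ k ih =>
      rw [pow_succ, ← mul_assoc, ih, mul_assoc, h, ← mul_assoc, ← pow_add, mul_add_one]
  have h2 : ∀ l k, ∃ i, w ^ l * a ^ k = a ^ i * w ^ l := by
    intro l
    induction l with
    | zero => intro k; exact ⟨k, by simp⟩
    | succ l ih =>
      intro k
      obtain ⟨i, hi⟩ := ih (j * k)
      exact ⟨i, by rw [pow_succ, mul_assoc, h1, ← mul_assoc, hi, mul_assoc]⟩
  let G : Submonoid D :=
    { carrier := {z | ∃ i l : ℕ, z = a ^ i * w ^ l}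
      one_mem' := ⟨0, 0, by simp⟩
      mul_mem' := by
        rintro _ _ ⟨i, l, rfl⟩ ⟨i', l', rfl⟩
        obtain ⟨k, hk⟩ := h2 l i'
        refine ⟨i + k, l + l', ?_⟩
        rw [pow_add, pow_add, mul_assoc, ← mul_assoc (w ^ l), hk]
        simp only [mul_assoc] }
  have hG : (G : Set D).Finite := by
    refine (Set.finite_range
      (fun p : Fin (orderOf a) × Fin (orderOf w) => a ^ (p.1 : ℕ) * w ^ (p.2 : ℕ))).subset ?_
    rintro _ ⟨i, l, rfl⟩
    exact ⟨(⟨i % orderOf a, Nat.mod_lt _ ha⟩, ⟨l % orderOf w, Nat.mod_lt _ hw⟩), by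
      simp [pow_mod_orderOf]⟩
  have hcl : Submonoid.closure {a, w} ≤ G := by
    rw [Submonoid.closure_le]
    rintro x (rfl | rfl)
    · exact ⟨1, 0, by simp⟩
    · exact ⟨0, 1, by simp⟩
  let S := Algebra.adjoin (ZMod 2) ({a, w} : Set D)
  have hfin : Module.Finite (ZMod 2) (Subalgebra.toSubmodule S) := by
    rw [Module.Finite.iff_fg, Algebra.adjoin_eq_span]
    exact Submodule.fg_span (hG.subset hcl)
  have : Finite S := Module.finite_of_finite (ZMod 2) (M := Subalgebra.toSubmodule S)
  have hcomm := (Finite.isDomain_to_isField S).mul_comm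
    ⟨w, Algebra.subset_adjoin (by simp)⟩ ⟨a, Algebra.subset_adjoin (by simp)⟩
  exact congrArg Subtype.val hcomm

theorem exists_pow_ne_one {D : Type*} [DivisionRing D] [CharP D 2]
    (hnc : ∃ a b : D, a * b ≠ b * a) : ∃ q : D, q ≠ 0 ∧ ∀ k : ℕ, 0 < k → q ^ k ≠ 1 := by
  by_contra! H
  have hord : ∀ x : D, x ≠ 0 → 0 < orderOf x := by
    intro x hx
    obtain ⟨k, hk, hxk⟩ := H x hx
    exact orderOf_pos_iff.2 (isOfFinOrder_iff_pow_eq_one.2 ⟨k, hk, hxk⟩)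
  obtain ⟨a, b, hab⟩ := hnc
  have ha : a ≠ 0 := by rintro rfl; simp at hab
  obtain ⟨w, hw, hwa, j, hj⟩ := exists_mul_eq_pow_mul a b hab (hord a ha)
  exact hwa (commute_of_mul_eq_pow_mul (hord a ha) (hord w hw) hj)

open scoped Matrix

open Submodule in
/-- A Jordan basis for a nilpotent endomorphism: a linearly independent spanning set
which is mapped into itself and zero, injectively away from the kernel. -/
theorem exists_jordan_set {D V : Type*} [DivisionRing D] [AddCommGroup V] [Module D V]
    (N : Module.End D V) (k : ℕ) (W : Submodule D V) (hW : W.map N ≤ W)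
    (hk : W.map (N ^ k) = ⊥) :
    ∃ b : Set V, LinearIndepOn D id b ∧ span D b = W ∧ (∀ s ∈ b, N s = 0 ∨ N s ∈ b) ∧
      Set.InjOn N {s ∈ b | N s ≠ 0} := by
  induction k generalizing W with
  | zero =>
    have : W = ⊥ := by rw [← hk, pow_zero, Module.End.one_eq_id, Submodule.map_id]
    exact ⟨∅, linearIndepOn_empty D id, by simp [this], by simp, by simp⟩
  | succ k ih =>
    obtain ⟨T, hT, hTW, hTN, hTinj⟩ := ih (W.map N) (Submodule.map_mono hW) (by
      rw [← Submodule.map_comp, ← Module.End.mul_eq_comp, ← pow_succ, hk])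
    have hTsub : ∀ t ∈ T, t ∈ W.map N := fun t ht => hTW ▸ subset_span ht
    have hT0 : ∀ t ∈ T, t ≠ 0 := fun t ht => hT.ne_zero ht
    have hg : ∀ t : V, ∃ g : V, t ∈ T → g ∈ W ∧ N g = t ∧ ∀ s ∈ T, N s = t → s = g := by
      intro t
      by_cases ht : t ∈ T
      · by_cases hs : ∃ s ∈ T, N s = t
        · obtain ⟨s, hs, rfl⟩ := hs
          exact ⟨s, fun _ => ⟨hW (hTsub s hs), rfl, fun s' hs' h =>
            hTinj ⟨hs', h ▸ hT0 _ ht⟩ ⟨hs, hT0 _ ht⟩ h⟩⟩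
        · obtain ⟨g, hg, hgt⟩ := hTsub t ht
          exact ⟨g, fun _ => ⟨hg, hgt, fun s' hs' h => absurd ⟨s', hs', h⟩ hs⟩⟩
      · exact ⟨0, fun h => absurd h ht⟩
    choose g hg using hg
    obtain ⟨κ, hκW, hκT, hκspan, hκ⟩ := exists_linearIndepOn_id_extension
      (K := D) (s := T ∩ LinearMap.ker N) (t := (W : Set V) ∩ LinearMap.ker N)
      (hT.mono Set.inter_subset_left)
      (Set.inter_subset_inter_left _ fun t ht => hW (hTsub t ht))
    have hNg : LinearIndepOn D N (g '' T) := by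
      have : LinearIndepOn D (N ∘ g) T := by
        refine (linearIndepOn_congr fun t ht => ?_).1 hT
        exact (hg t ht).2.1.symm
      exact this.image_of_comp
    have hLI : LinearIndepOn D (LinearMap.ker N).mkQ (g '' T) := by
      refine LinearIndependent.of_comp ((LinearMap.ker N).liftQ N le_rfl) ?_
      exact hNg
    refine ⟨κ ∪ g '' T, LinearIndepOn.union_id_of_quotient (fun x hx => (hκW hx).2) hκ hLI,
      le_antisymm ?_ ?_, ?_, ?_⟩
    · rw [span_le]
      rintro _ (hx | ⟨t, ht, rfl⟩)
      · exact (hκW hx).1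
      · exact (hg t ht).1
    · intro x hx
      have himg : N '' (g '' T) = T := by
        rw [Set.image_image]
        exact (Set.image_congr fun t ht => (hg t ht).2.1).trans (Set.image_id' T)
      have hNx : N x ∈ (span D (g '' T)).map N := by
        rw [map_span, himg, hTW]; exact mem_map_of_mem hx
      obtain ⟨y, hy, hyx⟩ := hNx
      have hyW : y ∈ W := by
        refine span_le.2 ?_ hy
        rintro _ ⟨t, ht, rfl⟩
        exact (hg t ht).1
      have hd : x - y ∈ span D κ := hκspan ⟨W.sub_mem hx hyW, by simp [hyx]⟩
      rw [← sub_add_cancel x y]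
      exact add_mem (span_mono Set.subset_union_left hd) (span_mono Set.subset_union_right hy)
    · rintro _ (hx | ⟨t, ht, rfl⟩)
      · exact Or.inl (hκW hx).2
      · right
        rw [(hg t ht).2.1]
        rcases hTN t ht with h | h
        · exact Or.inl (hκT ⟨ht, h⟩)
        · exact Or.inr ⟨N t, h, ((hg _ h).2.2 t ht rfl).symm⟩
    · have aux : ∀ s ∈ κ ∪ g '' T, N s ≠ 0 → g (N s) = s := by
        rintro _ (hx | ⟨t, ht, rfl⟩) h
        · exact absurd (hκW hx).2 h
        · rw [(hg t ht).2.1]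
      rintro s ⟨hs, hs0⟩ s' ⟨hs', hs0'⟩ h
      rw [← aux s hs hs0, h, aux s' hs' hs0']

/-- Over a division ring a nilpotent matrix is similar to a `0`/`1` matrix which lowers some
height function on the indices by one. -/
theorem exists_similar_zero_one {D ι : Type*} [DivisionRing D] [Fintype ι] [DecidableEq ι]
    (N : Matrix ι ι D) (hN : IsNilpotent N) :
    ∃ (P Q F : Matrix ι ι D) (h : ι → ℕ), P * Q = 1 ∧ Q * P = 1 ∧ P * N * Q = F ∧
      ∀ i j, F i j = 0 ∨ F i j = 1 ∧ h i = h j + 1 := by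
  classical
  obtain ⟨k, hk⟩ := hN
  have hpow : ∀ k, (Matrix.vecMulLinear N) ^ k = Matrix.vecMulLinear (N ^ k) := by
    intro k
    induction k with
    | zero => ext; simp
    | succ k ih =>
      rw [pow_succ', pow_succ, ih]
      refine LinearMap.ext fun v => ?_
      simp [Matrix.vecMul_vecMul]
  obtain ⟨b, hb, hspan, hbN, -⟩ := exists_jordan_set (Matrix.vecMulLinear N) k ⊤ le_top (by
    rw [hpow, hk]; ext; simp)
  let B : Module.Basis b D (ι → D) := Module.Basis.mk (v := ((↑) : b → ι → D)) hb (by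
    rw [Subtype.range_coe, hspan])
  let e : b ≃ ι := B.indexEquiv (Pi.basisFun D ι)
  let c : Module.Basis ι D (ι → D) := B.reindex e
  have hc : ∀ i, c i ∈ b := by
    intro i
    simp only [c, B, Module.Basis.reindex_apply]
    rw [show (Module.Basis.mk hb _) (e.symm i) = ((e.symm i : b) : ι → D) from
      Module.Basis.mk_apply hb _ _]
    exact (e.symm i).2
  have hcsurj : ∀ v ∈ b, ∃ i, c i = v := fun v hv => ⟨e ⟨v, hv⟩, by
    simp only [c, B, Module.Basis.reindex_apply, Equiv.symm_apply_apply]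
    exact Module.Basis.mk_apply hb _ _⟩
  let P : Matrix ι ι D := Matrix.of fun i => c i
  let Q : Matrix ι ι D := Matrix.of fun i => c.equivFun (Pi.single i 1)
  have hQP : Q * P = 1 := by
    refine Matrix.ext fun i j => ?_
    have := congrFun (c.sum_equivFun (Pi.single i 1)) j
    simpa [Matrix.mul_apply, Q, P, Matrix.one_apply, Pi.single_apply, eq_comm] using this
  let F : Matrix ι ι D := Matrix.of fun i j => if c i ᵥ* N = c j then 1 else 0
  have hPN : P * N = F * P := by
    refine Matrix.ext fun i j => ?_
    have hl : (P * N) i j = (c i ᵥ* N) j := rfl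
    have hr : (F * P) i j = ∑ l, F i l * c l j := rfl
    rw [hl, hr]
    rcases hbN _ (hc i) with h0 | hb'
    · have h0' : c i ᵥ* N = 0 := h0
      have : ∀ l, F i l = 0 := fun l => if_neg (by rw [h0']; exact (c.ne_zero l).symm)
      simp [this, h0']
    · obtain ⟨l, hl⟩ := hcsurj _ hb'
      have hl' : c i ᵥ* N = c l := hl.symm
      have : ∀ l', F i l' = if l = l' then 1 else 0 := by
        intro l'
        simp only [F, Matrix.of_apply, hl', c.injective.eq_iff]
      simp [this, hl']
  have hex : ∀ i, ∃ m, c i ᵥ* N ^ m = 0 := fun i => ⟨k, by rw [hk, Matrix.vecMul_zero]⟩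
  refine ⟨P, Q, F, fun i => Nat.find (hex i), mul_eq_one_comm.1 hQP, hQP, ?_, fun i j => ?_⟩
  · rw [hPN, mul_assoc, mul_eq_one_comm.1 hQP, mul_one]
  · by_cases hij : c i ᵥ* N = c j
    · right
      have hs : ∀ m, c i ᵥ* N ^ (m + 1) = c j ᵥ* N ^ m := fun m => by
        rw [pow_succ', ← Matrix.vecMul_vecMul, hij]
      refine ⟨if_pos hij, ?_⟩
      have hex' : ∃ m, c i ᵥ* N ^ (m + 1) = 0 := by simpa only [hs] using hex j
      exact (Nat.find_comp_succ (hex i) hex' (by simpa using c.ne_zero i)).trans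
        (congrArg (· + 1) (Nat.find_congr' (by simp only [hs, implies_true])))
    · exact Or.inl (if_neg hij)

section Unipotent

variable {D ι : Type*} [DivisionRing D] [Fintype ι] [DecidableEq ι]

theorem isDiagonalizable_diagonal (d : ι → D) : IsDiagonalizable (Matrix.diagonal d) :=
  ⟨1, 1, by simp, by simp, d, by simp⟩

theorem IsDiagonalizable.conj {M P Q : Matrix ι ι D} (hM : IsDiagonalizable M) (h : P * Q = 1) :
    IsDiagonalizable (P * M * Q) := by
  obtain ⟨R, S, hRS, hSR, d, hd⟩ := hM
  have h' := mul_eq_one_comm.1 h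
  refine ⟨P * R, S * Q, ?_, ?_, d, ?_⟩
  · rw [mul_assoc, ← mul_assoc R, hRS, one_mul, h]
  · rw [mul_assoc, ← mul_assoc Q, h', one_mul, hSR]
  · calc S * Q * (P * M * Q) * (P * R) = S * (Q * P) * M * (Q * P) * R := by
          simp only [mul_assoc]
      _ = Matrix.diagonal d := by rw [h', mul_one, mul_one, hd]

/-- The coefficients of the `q`-exponential series. -/
def qExpCoeff (q : D) : ℕ → D
  | 0 => 1
  | k + 1 => qExpCoeff q k * (q ^ (k + 1) - 1)⁻¹

theorem commute_qExpCoeff (q : D) (k : ℕ) : Commute q (qExpCoeff q k) := by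
  induction k with
  | zero => exact Commute.one_right q
  | succ k ih =>
    exact ih.mul_right (((Commute.refl q).pow_right _).sub_right (Commute.one_right q)).inv_right₀

theorem qExpCoeff_succ_mul {q : D} (hq : ∀ k : ℕ, 0 < k → q ^ k ≠ 1) (k : ℕ) :
    qExpCoeff q (k + 1) * q ^ (k + 1) = qExpCoeff q (k + 1) + qExpCoeff q k := by
  have h : qExpCoeff q (k + 1) * (q ^ (k + 1) - 1) = qExpCoeff q k := by
    rw [qExpCoeff, inv_mul_cancel_right₀ (sub_ne_zero.2 (hq _ k.succ_pos))]
  rw [← h, mul_sub, mul_one, add_sub_cancel]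

/-- If conjugation by the diagonal matrix `Δ` multiplies the nilpotent matrix `F` by `q`, then
the `q`-exponential of `F` conjugates `(1 + F) * Δ` to `Δ`. -/
theorem isDiagonalizable_one_add_mul {q : D} (hq : ∀ k : ℕ, 0 < k → q ^ k ≠ 1)
    {F : Matrix ι ι D} {h : ι → ℕ} (hF : IsNilpotent F)
    (hFh : ∀ i j, F i j = 0 ∨ F i j = 1 ∧ h i = h j + 1) :
    IsDiagonalizable ((1 + F) * Matrix.diagonal fun i => q ^ h i) := by
  obtain ⟨m, hm⟩ := hF
  set Δ : Matrix ι ι D := Matrix.diagonal fun i => q ^ h i with hΔ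
  have hFc : ∀ (c : D) (M : Matrix ι ι D), F * (c • M) = c • (F * M) := by
    intro c M
    ext i j
    simp only [Matrix.mul_apply, Matrix.smul_apply, smul_eq_mul, Finset.mul_sum]
    refine Finset.sum_congr rfl fun l _ => ?_
    rcases hFh i l with h | ⟨h, -⟩ <;> simp [h]
  have hΔF : Δ * F = q • (F * Δ) := by
    ext i j
    rw [Matrix.diagonal_mul, Matrix.smul_apply, Matrix.mul_diagonal]
    rcases hFh i j with h | ⟨h, h'⟩
    · simp [h]
    · simp [h, h', pow_succ']
  have hΔFk : ∀ k : ℕ, Δ * F ^ k = q ^ k • (F ^ k * Δ) := by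
    intro k
    induction k with
    | zero => simp
    | succ k ih =>
      rw [pow_succ', ← mul_assoc, hΔF, smul_mul_assoc, mul_assoc, ih, hFc, smul_smul, ← pow_succ',
        mul_assoc]
  have hΔc : ∀ (k : ℕ) (M : Matrix ι ι D), Δ * (qExpCoeff q k • M) = qExpCoeff q k • (Δ * M) := by
    intro k M
    ext i j
    rw [Matrix.diagonal_mul, Matrix.smul_apply, Matrix.smul_apply, Matrix.diagonal_mul,
      smul_eq_mul, smul_eq_mul, ← mul_assoc, ← mul_assoc,
      ((commute_qExpCoeff q k).pow_left (h i)).eq]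
  let R : Matrix ι ι D := ∑ k ∈ Finset.range m, qExpCoeff q (k + 1) • F ^ k
  let Q : Matrix ι ι D := ∑ k ∈ Finset.range (m + 1), qExpCoeff q k • F ^ k
  have hFR : Commute F R := Commute.sum_right _ _ _ fun k _ => by
    rw [commute_iff_eq, hFc, smul_mul_assoc, ← pow_succ', pow_succ]
  have hQR : Q = 1 + F * R := by
    simp only [Q, R, Finset.sum_range_succ', Finset.mul_sum, hFc, ← pow_succ']
    rw [add_comm]; simp [qExpCoeff]
  have hQ : IsUnit Q := hQR ▸ (hFR.isNilpotent_mul_right ⟨m, hm⟩).isUnit_one_add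
  obtain ⟨Q', hQ'⟩ := hQ.exists_right_inv
  have key : Q * ((1 + F) * Δ) = Δ * Q := by
    have h1 : Q * ((1 + F) * Δ) = ∑ k ∈ Finset.range (m + 1), qExpCoeff q k • (F ^ k * Δ) +
        ∑ k ∈ Finset.range (m + 1), qExpCoeff q k • (F ^ (k + 1) * Δ) := by
      rw [add_mul, one_mul, mul_add, Finset.sum_mul, Finset.sum_mul]
      simp only [smul_mul_assoc, ← mul_assoc, ← pow_succ]
    have h2 : Δ * Q = ∑ k ∈ Finset.range (m + 1), (qExpCoeff q k * q ^ k) • (F ^ k * Δ) := by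
      rw [Finset.mul_sum]
      simp only [hΔc, hΔFk, smul_smul]
    rw [h1, h2, Finset.sum_range_succ', Finset.sum_range_succ _ m, pow_succ F m, hm,
      Finset.sum_range_succ' _ m]
    simp only [qExpCoeff_succ_mul hq, add_smul, Finset.sum_add_distrib]
    simp only [zero_mul, smul_zero, add_zero, pow_zero, mul_one]
    abel
  have : (1 + F) * Δ = Q' * Δ * Q := by
    rw [mul_assoc, ← key, ← mul_assoc, mul_eq_one_comm.1 hQ', one_mul]
  rw [this]
  exact (isDiagonalizable_diagonal _).conj (mul_eq_one_comm.1 hQ')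

theorem exists_isDiagonalizable_mul_of_isNilpotent_sub_one {q : D} (hq0 : q ≠ 0)
    (hq : ∀ k : ℕ, 0 < k → q ^ k ≠ 1) {U : Matrix ι ι D} (hU : IsNilpotent (U - 1)) :
    ∃ B C, IsDiagonalizable B ∧ IsDiagonalizable C ∧ U = B * C := by
  obtain ⟨P, Q, F, h, hPQ, hQP, hF, hFh⟩ := exists_similar_zero_one _ hU
  have hFnil : IsNilpotent F := by
    obtain ⟨m, hm⟩ := hU
    have : ∀ k, F ^ k = P * (U - 1) ^ k * Q := by
      intro k
      induction k with
      | zero => simp [hPQ]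
      | succ k ih =>
        rw [pow_succ, ih, ← hF, pow_succ]
        calc P * (U - 1) ^ k * Q * (P * (U - 1) * Q)
            = P * (U - 1) ^ k * (Q * P) * (U - 1) * Q := by simp only [mul_assoc]
          _ = _ := by rw [hQP, mul_one]; simp only [mul_assoc]
    exact ⟨m, by simp [this, hm]⟩
  set Δ : Matrix ι ι D := Matrix.diagonal fun i => q ^ h i with hΔ
  set Δ' : Matrix ι ι D := Matrix.diagonal fun i => (q ^ h i)⁻¹ with hΔ'
  have hΔΔ : Δ * Δ' = 1 := by
    simp [hΔ, hΔ', Matrix.diagonal_mul_diagonal, hq0]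
  refine ⟨Q * ((1 + F) * Δ) * P, Q * Δ' * P, (isDiagonalizable_one_add_mul hq hFnil hFh).conj hQP,
    (isDiagonalizable_diagonal _).conj hQP, ?_⟩
  calc U = (Q * P) * U * (Q * P) := by simp [hQP]
    _ = Q * (1 + F) * P := by
      have : 1 + F = P * U * Q := by rw [← hF, mul_sub, sub_mul, mul_one, hPQ]; abel
      rw [this]; simp only [mul_assoc]
    _ = Q * (1 + F) * (Δ * Δ') * P := by rw [hΔΔ, mul_one]
    _ = Q * ((1 + F) * Δ) * (P * Q) * Δ' * P := by rw [hPQ]; simp only [mul_assoc, one_mul]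
    _ = _ := by simp only [mul_assoc]

end Unipotent

section Blocks

open Matrix

variable {D : Type*} [DivisionRing D] {ι κ α β : Type}

section

variable [Fintype ι] [DecidableEq ι] [Fintype κ] [DecidableEq κ] [Fintype α] [DecidableEq α]
  [Fintype β] [DecidableEq β]

theorem IsDiagonalizable.submatrix {M : Matrix κ κ D} (hM : IsDiagonalizable M) (e : ι ≃ κ) :
    IsDiagonalizable (M.submatrix e e) := by
  obtain ⟨P, Q, hPQ, hQP, d, hd⟩ := hM
  refine ⟨P.submatrix e e, Q.submatrix e e, ?_, ?_, d ∘ e, ?_⟩ <;>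
    simp [submatrix_mul_equiv, hPQ, hQP, hd]

theorem IsDiagonalizable.fromBlocks_diagonal {M : Matrix α α D} (hM : IsDiagonalizable M)
    (d : β → D) : IsDiagonalizable (fromBlocks M 0 0 (diagonal d)) := by
  obtain ⟨P, Q, hPQ, hQP, c, hc⟩ := hM
  refine ⟨fromBlocks P 0 0 1, fromBlocks Q 0 0 1, ?_, ?_, Sum.elim c d, ?_⟩ <;>
    simp [fromBlocks_multiply, hPQ, hQP, hc]

theorem exists_mul_add_mul_diagonal_eq {N : Matrix α α D} (hN : IsNilpotent N) {d : β → D}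
    (hd : ∀ j, d j ≠ 0) (X : Matrix α β D) : ∃ Y : Matrix α β D, N * Y + Y * diagonal d = X := by
  have hdd : diagonal (fun j => (d j)⁻¹) * diagonal d = 1 := by
    simp [diagonal_mul_diagonal, hd]
  suffices h : ∀ (k : ℕ) (X : Matrix α β D), N ^ k * X = 0 →
      ∃ Y : Matrix α β D, N * Y + Y * diagonal d = X by
    obtain ⟨k, hk⟩ := hN
    exact h k X (by rw [hk, Matrix.zero_mul])
  intro k
  induction k with
  | zero => intro X hX; exact ⟨0, by simpa using hX.symm⟩
  | succ k ih =>
    intro X hX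
    set Z := X * diagonal fun j => (d j)⁻¹ with hZ
    have hZd : Z * diagonal d = X := by rw [hZ, Matrix.mul_assoc, hdd, Matrix.mul_one]
    obtain ⟨Y, hY⟩ := ih (-(N * Z)) (by
      rw [Matrix.mul_neg, ← Matrix.mul_assoc, ← pow_succ, hZ, ← Matrix.mul_assoc, hX]; simp)
    refine ⟨Z + Y, ?_⟩
    rw [Matrix.mul_add, Matrix.add_mul, hZd]
    calc N * Z + N * Y + (X + Y * diagonal d) = N * Z + (N * Y + Y * diagonal d) + X := by abel
      _ = X := by rw [hY]; simp

theorem isNilpotent_fromBlocks_zero₂₁ {N : Matrix β β D} (hN : IsNilpotent N)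
    (X : Matrix α β D) : IsNilpotent (fromBlocks (0 : Matrix α α D) X 0 N) := by
  obtain ⟨k, hk⟩ := hN
  have h : ∀ k, fromBlocks (0 : Matrix α α D) X 0 N ^ (k + 1) =
      fromBlocks 0 (X * N ^ k) 0 (N ^ (k + 1)) := by
    intro k
    induction k with
    | zero => simp
    | succ k ih => rw [pow_succ, ih, fromBlocks_multiply]; simp [pow_succ, Matrix.mul_assoc]
  exact ⟨k + 1, by simp [h, hk, pow_succ]⟩

theorem isNilpotent_fromBlocks_zero₁₂ {N : Matrix β β D} (hN : IsNilpotent N)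
    (Y : Matrix β α D) : IsNilpotent (fromBlocks (0 : Matrix α α D) 0 Y N) := by
  obtain ⟨k, hk⟩ := hN
  have h : ∀ k, fromBlocks (0 : Matrix α α D) 0 Y N ^ (k + 1) =
      fromBlocks 0 0 (N ^ k * Y) (N ^ (k + 1)) := by
    intro k
    induction k with
    | zero => simp
    | succ k ih =>
      rw [pow_succ', ih, fromBlocks_multiply]; simp [pow_succ', Matrix.mul_assoc]
  exact ⟨k + 1, by simp [h, hk, pow_succ]⟩

end

/-- Up to a reindexing, `U` is block upper triangular with a unipotent block followed by
a diagonal block without eigenvalue `1`. -/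
def IsUnipotentByDiagonal (U : Matrix ι ι D) : Prop :=
  ∃ (α β : Type) (_ : Fintype α) (_ : DecidableEq α) (_ : Fintype β) (_ : DecidableEq β)
    (e : ι ≃ α ⊕ β) (V : Matrix α α D) (X : Matrix α β D) (d : β → D),
    IsNilpotent (V - 1) ∧ (∀ j, d j ≠ 1) ∧ U = (fromBlocks V X 0 (diagonal d)).submatrix e e

theorem IsUnipotentByDiagonal.submatrix {U : Matrix κ κ D} (hU : IsUnipotentByDiagonal U)
    (e : ι ≃ κ) : IsUnipotentByDiagonal (U.submatrix e e) := by
  obtain ⟨α, β, _, _, _, _, f, V, X, d, hV, hd, rfl⟩ := hU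
  exact ⟨α, β, inferInstance, inferInstance, inferInstance, inferInstance,
    e.trans f, V, X, d, hV, hd, rfl⟩

variable [Fintype ι] [DecidableEq ι]

theorem isUnipotentByDiagonal_diagonal (d : ι → D) : IsUnipotentByDiagonal (diagonal d) := by
  classical
  refine ⟨{i // d i = 1}, {i // ¬d i = 1}, inferInstance, inferInstance, inferInstance,
    inferInstance, (Equiv.sumCompl fun i => d i = 1).symm, 1, 0, fun j => d j, by simp,
    fun j => j.2, ?_⟩
  have h1 : (1 : Matrix {i // d i = 1} {i // d i = 1} D) =
      diagonal fun i => d i.1 := by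
    rw [← diagonal_one]; congr 1; ext i; exact i.2.symm
  rw [h1, Matrix.fromBlocks_diagonal, submatrix_diagonal_equiv]
  congr 1
  ext i
  obtain ⟨j, rfl⟩ := (Equiv.sumCompl fun i => d i = 1).surjective i
  rcases j with j | j <;> simp

theorem IsUnipotentByDiagonal.fromBlocks {U : Matrix κ κ D} (hU : IsUnipotentByDiagonal U)
    (x : Matrix ι κ D) : IsUnipotentByDiagonal (fromBlocks 1 x 0 U) := by
  obtain ⟨α, β, _, _, _, _, f, V, X, d, hV, hd, rfl⟩ := hU
  refine ⟨ι ⊕ α, β, inferInstance, inferInstance, inferInstance, inferInstance,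
    (Equiv.sumCongr (Equiv.refl ι) f).trans (Equiv.sumAssoc ι α β).symm,
    Matrix.fromBlocks 1 (of fun i a => x i (f.symm (Sum.inl a))) 0 V,
    fromRows (of fun i b => x i (f.symm (Sum.inr b))) X, d, ?_, hd, ?_⟩
  · rw [← fromBlocks_one, sub_eq_add_neg, fromBlocks_neg, fromBlocks_add]
    simpa [← sub_eq_add_neg] using isNilpotent_fromBlocks_zero₂₁ hV _
  · ext (i | i) (j | j)
    · rfl
    · obtain ⟨j, rfl⟩ := f.symm.surjective j
      rcases j with j | j <;> simp
    · obtain ⟨i, rfl⟩ := f.symm.surjective i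
      rcases i with i | i <;> simp
    · obtain ⟨i, rfl⟩ := f.symm.surjective i
      obtain ⟨j, rfl⟩ := f.symm.surjective j
      rcases i with i | i <;> rcases j with j | j <;> simp

theorem IsUnipotentByDiagonal.exists_isDiagonalizable_mul {q : D} (hq0 : q ≠ 0)
    (hq : ∀ k : ℕ, 0 < k → q ^ k ≠ 1) {U : Matrix ι ι D} (hU : IsUnipotentByDiagonal U) :
    ∃ B C, IsDiagonalizable B ∧ IsDiagonalizable C ∧ U = B * C := by
  obtain ⟨α, β, _, _, _, _, e, V, X, d, hV, hd, rfl⟩ := hU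
  obtain ⟨B, C, hB, hC, rfl⟩ := exists_isDiagonalizable_mul_of_isNilpotent_sub_one hq0 hq hV
  obtain ⟨Y, hY⟩ := exists_mul_add_mul_diagonal_eq hV (d := fun j => 1 - d j)
    (fun j => sub_ne_zero.2 (hd j).symm) X
  have hY' : B * C * Y + -(Y * diagonal d) = X := by
    have h1 : diagonal (fun j => 1 - d j) = (1 : Matrix β β D) - diagonal d := by
      rw [← diagonal_one, diagonal_sub]
    rw [← hY, h1, Matrix.sub_mul, Matrix.mul_sub, Matrix.one_mul, Matrix.mul_one]
    abel
  have hPQ : Matrix.fromBlocks 1 (-Y) 0 1 * Matrix.fromBlocks 1 Y 0 1 =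
      (1 : Matrix (α ⊕ β) (α ⊕ β) D) := by
    simp [fromBlocks_multiply]
  refine ⟨_, _, ((hB.fromBlocks_diagonal d).conj hPQ).submatrix e,
    ((hC.fromBlocks_diagonal fun _ => 1).conj hPQ).submatrix e, ?_⟩
  rw [submatrix_mul_equiv]
  congr 1
  simp only [fromBlocks_multiply, ← hY']
  simp [Matrix.mul_assoc, Matrix.mul_add]

variable [Fintype κ] [DecidableEq κ]

/-- `A` is similar to a product of a unipotent matrix and a unipotent-by-diagonal one. -/
def HasGaussForm (A : Matrix ι ι D) : Prop :=
  ∃ P Q L U : Matrix ι ι D, P * Q = 1 ∧ IsNilpotent (L - 1) ∧ IsUnipotentByDiagonal U ∧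
    P * A * Q = L * U

theorem HasGaussForm.submatrix {A : Matrix κ κ D} (hA : HasGaussForm A) (e : ι ≃ κ) :
    HasGaussForm (A.submatrix e e) := by
  obtain ⟨P, Q, L, U, hPQ, hL, hU, h⟩ := hA
  refine ⟨P.submatrix e e, Q.submatrix e e, L.submatrix e e, U.submatrix e e, ?_, ?_,
    hU.submatrix e, ?_⟩
  · rw [submatrix_mul_equiv, hPQ, submatrix_one_equiv]
  · have := hL.map (reindexRingEquiv D e.symm)
    rwa [map_sub, map_one] at this
  · simp only [submatrix_mul_equiv, h]

theorem HasGaussForm.of_conj {A P Q : Matrix ι ι D} (hA : HasGaussForm (P * A * Q))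
    (h : P * Q = 1) : HasGaussForm A := by
  obtain ⟨P', Q', L, U, hPQ, hL, hU, hLU⟩ := hA
  refine ⟨P' * P, Q * Q', L, U, ?_, hL, hU, ?_⟩
  · rw [mul_assoc, ← mul_assoc P, h, one_mul, hPQ]
  · rw [← hLU]; simp only [mul_assoc]

theorem HasGaussForm.fromBlocks {B : Matrix κ κ D} {x : Matrix ι κ D} {y : Matrix κ ι D}
    (h : HasGaussForm (B - y * x)) : HasGaussForm (fromBlocks 1 x y B) := by
  obtain ⟨P, Q, L, U, hPQ, hL, hU, hLU⟩ := h
  refine ⟨Matrix.fromBlocks 1 0 0 P, Matrix.fromBlocks 1 0 0 Q, Matrix.fromBlocks 1 0 (P * y) L,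
    Matrix.fromBlocks 1 (x * Q) 0 U, by simp [fromBlocks_multiply, hPQ], ?_,
    hU.fromBlocks _, ?_⟩
  · rw [← fromBlocks_one, sub_eq_add_neg, fromBlocks_neg, fromBlocks_add]
    simpa [← sub_eq_add_neg] using isNilpotent_fromBlocks_zero₁₂ hL _
  · simp only [fromBlocks_multiply, ← hLU]
    simp [Matrix.mul_sub, Matrix.sub_mul, Matrix.mul_assoc]

theorem exists_conj_apply_eq_one {A : Matrix ι ι D} {i j : ι} (hij : i ≠ j) (hA : A i j ≠ 0) :
    ∃ P Q : Matrix ι ι D, P * Q = 1 ∧ (P * A * Q) i i = 1 := by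
  let c := (A i j)⁻¹ * (A i i - 1)
  refine ⟨1 + single j i c, 1 - single j i c, ?_, ?_⟩
  · rw [add_mul, mul_sub, mul_sub, single_mul_single_of_ne (h := hij)]
    simp
  · have h1 : ∀ k, ((1 + single j i c) * A) i k = A i k := fun k => by
      rw [Matrix.add_mul, Matrix.one_mul, Matrix.add_apply, single_mul_apply_of_ne _ _ _ _ _ hij,
        add_zero]
    rw [Matrix.mul_sub, Matrix.mul_one, Matrix.sub_apply, mul_single_apply_same, h1, h1]
    simp [c, hA]

theorem hasGaussForm (A : Matrix ι ι D) : HasGaussForm A := by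
  obtain ⟨n, hn⟩ : ∃ n, Fintype.card ι = n := ⟨_, rfl⟩
  induction n using Nat.strong_induction_on generalizing ι with
  | _ n ih =>
    by_cases hdiag : ∀ i j, i ≠ j → A i j = 0
    · refine ⟨1, 1, 1, A, by simp, by simp, ?_, by simp⟩
      have : A = diagonal fun i => A i i := by
        ext i j
        by_cases h : i = j
        · simp [h]
        · simp [h, hdiag i j h]
      rw [this]
      exact isUnipotentByDiagonal_diagonal _
    · push Not at hdiag
      obtain ⟨i, j, hij, hA⟩ := hdiag
      obtain ⟨P, Q, hPQ, h1⟩ := exists_conj_apply_eq_one hij hA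
      refine HasGaussForm.of_conj ?_ hPQ
      set A' := P * A * Q
      let s := Equiv.sumCompl fun k => k = i
      suffices h : HasGaussForm (A'.submatrix s s) by
        simpa using h.submatrix s.symm
      rw [← fromBlocks_toBlocks (A'.submatrix s s)]
      have h11 : (A'.submatrix s s).toBlocks₁₁ = 1 := by
        ext ⟨a, ha⟩ ⟨b, hb⟩
        subst ha
        subst hb
        simpa [toBlocks₁₁, s] using h1
      rw [h11]
      refine HasGaussForm.fromBlocks (ih _ ?_ _ rfl)
      rw [← hn]
      exact Fintype.card_subtype_lt (x := i) (by simp)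

end Blocks

/-- Over a noncommutative division ring of characteristic 2 with at least four
    elements, every n×n matrix is a product of four diagonalizable matrices. -/
theorem stmt_13 (D : Type*) [DivisionRing D] (hnc : ∃ a b : D, a * b ≠ b * a)
    (hchar : ringChar D = 2) (hcard : 4 ≤ Cardinal.mk D)
    {n : ℕ} (hn : 0 < n) (A : Matrix (Fin n) (Fin n) D) :
    ∃ B C E G : Matrix (Fin n) (Fin n) D,
      IsDiagonalizable B ∧ IsDiagonalizable C ∧ IsDiagonalizable E ∧
      IsDiagonalizable G ∧ A = B * C * E * G := by
  have : CharP D 2 := ringChar.of_eq hchar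
  obtain ⟨q, hq0, hq⟩ := exists_pow_ne_one hnc
  obtain ⟨P, Q, L, U, hPQ, hL, hU, hLU⟩ := hasGaussForm A
  obtain ⟨B, C, hB, hC, rfl⟩ := exists_isDiagonalizable_mul_of_isNilpotent_sub_one hq0 hq hL
  obtain ⟨E, G, hE, hG, rfl⟩ := hU.exists_isDiagonalizable_mul hq0 hq
  have hQP := mul_eq_one_comm.1 hPQ
  refine ⟨Q * B * P, Q * C * P, Q * E * P, Q * G * P, hB.conj hQP, hC.conj hQP, hE.conj hQP,
    hG.conj hQP, ?_⟩
  calc A = (Q * P) * A * (Q * P) := by rw [hQP, one_mul, mul_one]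
    _ = Q * (P * A * Q) * P := by simp only [mul_assoc]
    _ = Q * B * (P * Q) * C * (P * Q) * E * (P * Q) * G * P := by
      rw [hLU, hPQ]; simp only [mul_assoc, one_mul]
    _ = _ := by simp only [mul_assoc]
end

section
/- Let D be a division ring that is not the field with two elements and let N be a nilpotent n×n matrix over D. Then N can be written as a product of two diagonalizable matrices over D. -/
section DiagonalizableEnd

variable {D : Type*} [DivisionRing D]
variable {V W X : Type*} [AddCommGroup V] [Module D V] [AddCommGroup W] [Module D W]
  [AddCommGroup X] [Module D X]

/-- The set of eigenvectors (including `0`) of an endomorphism. -/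
def eigenvectorSet (f : V →ₗ[D] V) : Set V := {v | ∃ c : D, f v = c • v}

/-- An endomorphism is diagonalizable when its eigenvectors span. -/
def IsDiagonalizableEnd (f : V →ₗ[D] V) : Prop :=
  Submodule.span D (eigenvectorSet f) = ⊤

/-- An endomorphism which is a composition of two diagonalizable ones. -/
def IsProductOfDiagonalizable (f : V →ₗ[D] V) : Prop :=
  ∃ B C : V →ₗ[D] V, IsDiagonalizableEnd B ∧ IsDiagonalizableEnd C ∧ f = B ∘ₗ C

theorem isDiagonalizableEnd_zero : IsDiagonalizableEnd (0 : V →ₗ[D] V) := by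
  have h : eigenvectorSet (0 : V →ₗ[D] V) = Set.univ :=
    Set.eq_univ_of_forall fun v => ⟨0, by simp⟩
  simp [IsDiagonalizableEnd, h]

theorem apply_mem_span_eigenvectorSet {g : X →ₗ[D] X} {f : V →ₗ[D] V} {s : X →ₗ[D] V}
    (hs : f ∘ₗ s = s ∘ₗ g) (hg : IsDiagonalizableEnd g) (x : X) :
    s x ∈ Submodule.span D (eigenvectorSet f) := by
  have hx : x ∈ Submodule.span D (eigenvectorSet g) := by
    rw [show Submodule.span D (eigenvectorSet g) = ⊤ from hg]; trivial
  have hle : Submodule.span D (eigenvectorSet g) ≤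
      (Submodule.span D (eigenvectorSet f)).comap s := by
    rw [Submodule.span_le]
    rintro y ⟨c, hc⟩
    refine Submodule.subset_span ⟨c, ?_⟩
    have := LinearMap.congr_fun hs y
    simpa [hc] using this
  exact hle hx

theorem IsDiagonalizableEnd.of_semiconj {g : X →ₗ[D] X} {f : V →ₗ[D] V} {s : X →ₗ[D] V}
    (hs : f ∘ₗ s = s ∘ₗ g) (hsurj : Function.Surjective s) (hg : IsDiagonalizableEnd g) :
    IsDiagonalizableEnd f := by
  refine eq_top_iff.2 fun v _ => ?_
  obtain ⟨x, rfl⟩ := hsurj v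
  exact apply_mem_span_eigenvectorSet hs hg x

theorem IsProductOfDiagonalizable.conj {f : V →ₗ[D] V} (hf : IsProductOfDiagonalizable f)
    {s : X →ₗ[D] V} {p : V →ₗ[D] X} (hps : p ∘ₗ s = LinearMap.id) (hsp : s ∘ₗ p = LinearMap.id) :
    IsProductOfDiagonalizable (p ∘ₗ f ∘ₗ s) := by
  obtain ⟨B, C, hB, hC, rfl⟩ := hf
  have hsp' : ∀ v, s (p v) = v := fun v => LinearMap.congr_fun hsp v
  have hsurj : Function.Surjective p := fun x => ⟨s x, LinearMap.congr_fun hps x⟩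
  refine ⟨p ∘ₗ B ∘ₗ s, p ∘ₗ C ∘ₗ s, hB.of_semiconj ?_ hsurj, hC.of_semiconj ?_ hsurj, ?_⟩ <;>
  · ext; simp [hsp']

theorem IsDiagonalizableEnd.directSum {g : X →ₗ[D] X} {h : W →ₗ[D] W}
    (hg : IsDiagonalizableEnd g) (hh : IsDiagonalizableEnd h)
    {s : X →ₗ[D] V} {p : V →ₗ[D] X} {ι : W →ₗ[D] V} {q : V →ₗ[D] W}
    (hps : ∀ x, p (s x) = x) (hqι : ∀ w, q (ι w) = w) (hqs : ∀ x, q (s x) = 0)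
    (hpι : ∀ w, p (ι w) = 0) (hsum : ∀ v, s (p v) + ι (q v) = v) :
    IsDiagonalizableEnd (s ∘ₗ g ∘ₗ p + ι ∘ₗ h ∘ₗ q) := by
  refine eq_top_iff.2 fun v _ => ?_
  rw [← hsum v]
  refine Submodule.add_mem _ (apply_mem_span_eigenvectorSet ?_ hg _)
    (apply_mem_span_eigenvectorSet ?_ hh _)
  · ext x; simp [hps, hqs]
  · ext x; simp [hqι, hpι]

theorem IsProductOfDiagonalizable.directSum {g : X →ₗ[D] X} {h : W →ₗ[D] W}
    (hg : IsProductOfDiagonalizable g) (hh : IsProductOfDiagonalizable h)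
    {s : X →ₗ[D] V} {p : V →ₗ[D] X} {ι : W →ₗ[D] V} {q : V →ₗ[D] W}
    (hps : ∀ x, p (s x) = x) (hqι : ∀ w, q (ι w) = w) (hqs : ∀ x, q (s x) = 0)
    (hpι : ∀ w, p (ι w) = 0) (hsum : ∀ v, s (p v) + ι (q v) = v) :
    IsProductOfDiagonalizable (s ∘ₗ g ∘ₗ p + ι ∘ₗ h ∘ₗ q) := by
  obtain ⟨B, C, hB, hC, rfl⟩ := hg
  obtain ⟨B', C', hB', hC', rfl⟩ := hh
  refine ⟨_, _, hB.directSum hB' hps hqι hqs hpι hsum, hC.directSum hC' hps hqι hqs hpι hsum, ?_⟩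
  ext x
  simp [hps, hqι, hqs, hpι]

/-- The nilpotent left shift on `Fin n → D`. -/
def leftShift (D : Type*) [DivisionRing D] (n : ℕ) : (Fin n → D) →ₗ[D] (Fin n → D) :=
  LinearMap.pi fun i => if h : (i : ℕ) + 1 < n then LinearMap.proj ⟨i + 1, h⟩ else 0

theorem leftShift_apply {n : ℕ} (w : Fin n → D) (i : Fin n) :
    leftShift D n w i = if h : (i : ℕ) + 1 < n then w ⟨i + 1, h⟩ else 0 := by
  rw [leftShift, LinearMap.pi_apply]
  split_ifs <;> rfl

/-- A nilpotent endomorphism of index `k + 1` splits off a shift of size `k + 1`. -/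
theorem exists_leftShift_retract {f : V →ₗ[D] V} {k : ℕ} (hf : f ^ (k + 1) = 0) {v : V}
    {φ : V →ₗ[D] D} (hφ : φ ((f ^ k) v) ≠ 0) :
    ∃ (p : V →ₗ[D] (Fin (k + 1) → D)) (s : (Fin (k + 1) → D) →ₗ[D] V),
      p ∘ₗ s = LinearMap.id ∧ p ∘ₗ f = leftShift D (k + 1) ∘ₗ p ∧
        f ∘ₗ s = s ∘ₗ leftShift D (k + 1) := by
  have hz : ∀ m, k < m → f ^ m = 0 := fun m hm => pow_eq_zero_of_le hm hf
  let p : V →ₗ[D] (Fin (k + 1) → D) := LinearMap.pi fun i => φ ∘ₗ (f ^ (i : ℕ))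
  have hpa : ∀ w i, p w i = φ ((f ^ (i : ℕ)) w) := fun w i => rfl
  have hpf : p ∘ₗ f = leftShift D (k + 1) ∘ₗ p := by
    refine LinearMap.ext fun w => funext fun i => ?_
    simp only [LinearMap.comp_apply, leftShift_apply, hpa]
    rw [← Module.End.mul_apply, ← pow_succ]
    split_ifs with h
    · rfl
    · rw [hz _ (by omega)]; simp
  have hli : LinearIndependent D fun i : Fin (k + 1) => p ((f ^ (i : ℕ)) v) := by
    rw [Fintype.linearIndependent_iff]
    intro g hg
    suffices H : ∀ n (hn : n < k + 1), g ⟨n, hn⟩ = 0 from fun i => H i i.2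
    intro n
    induction n using Nat.strong_induction_on with
    | _ n ih =>
      intro hn
      have h1 := congrFun hg ⟨k - n, by omega⟩
      simp only [Finset.sum_apply, Pi.smul_apply, hpa, ← Module.End.mul_apply, ← pow_add,
        Pi.zero_apply, smul_eq_mul] at h1
      rw [Finset.sum_eq_single ⟨n, hn⟩] at h1
      · rw [show k - n + n = k by omega] at h1
        exact (mul_eq_zero.1 h1).resolve_right hφ
      · intro j _ hj
        rcases lt_trichotomy (j : ℕ) n with h | h | h
        · rw [ih j h j.2, zero_mul]
        · exact absurd (Fin.ext h) hj
        · rw [hz _ (by omega)]; simp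
      · simp
  let b := basisOfLinearIndependentOfCardEqFinrank hli (by simp)
  have hb : ∀ i, b i = p ((f ^ (i : ℕ)) v) := fun i => by simp [b]
  let s := b.constr ℕ fun i => (f ^ (i : ℕ)) v
  have hs : ∀ i, s (b i) = (f ^ (i : ℕ)) v := fun i => by simp [s]
  refine ⟨p, s, b.ext fun i => ?_, hpf, b.ext fun i => ?_⟩
  · rw [LinearMap.comp_apply, hs, hb, LinearMap.id_apply]
  · simp only [LinearMap.comp_apply, hs]
    rw [hb, ← LinearMap.comp_apply (leftShift D (k + 1)), ← hpf, LinearMap.comp_apply,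
      ← Module.End.mul_apply, ← pow_succ']
    by_cases h : (i : ℕ) + 1 < k + 1
    · exact (hs ⟨i + 1, h⟩).symm.trans (by rw [hb])
    · rw [hz _ (by omega)]; simp

theorem mem_span_eigenvectorSet_of_pair {f : V →ₗ[D] V} {a : D} (ha : a ≠ 1) {y z : V}
    (hy : f y = (1 + a) • y + z) (hz : f z = -(a • y)) :
    y ∈ Submodule.span D (eigenvectorSet f) ∧ z ∈ Submodule.span D (eigenvectorSet f) := by
  have h1 : y + z ∈ Submodule.span D (eigenvectorSet f) := by
    refine Submodule.subset_span ⟨1, ?_⟩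
    rw [map_add, hy, hz, add_smul, one_smul, one_smul]; abel
  have h2 : a • y + z ∈ Submodule.span D (eigenvectorSet f) := by
    refine Submodule.subset_span ⟨a, ?_⟩
    rw [map_add, map_smul, hy, hz, add_smul, one_smul, smul_add, smul_add, smul_add]; abel
  have h3 : y ∈ Submodule.span D (eigenvectorSet f) := by
    have := Submodule.smul_mem _ (1 - a)⁻¹ (Submodule.sub_mem _ h1 h2)
    rwa [show y + z - (a • y + z) = (1 - a) • y by rw [sub_smul, one_smul]; abel, smul_smul,
      inv_mul_cancel₀ (sub_ne_zero.2 ha.symm), one_smul] at this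
  exact ⟨h3, by simpa using Submodule.sub_mem _ h1 h3⟩

/-- The standard basis vectors of `Fin n → D`, extended by zero to all natural indices. -/
def stdVec (D : Type*) [DivisionRing D] (n i : ℕ) : Fin n → D :=
  fun j => if (j : ℕ) = i then 1 else 0

theorem stdVec_eq_zero {n i : ℕ} (h : n ≤ i) : stdVec D n i = 0 := by
  funext j
  have := j.2
  simp only [stdVec, Pi.zero_apply, ite_eq_right_iff]
  omega

theorem basisFun_eq_stdVec {n : ℕ} (i : Fin n) : Pi.basisFun D (Fin n) i = stdVec D n i := by
  funext j
  simp [stdVec, Pi.single_apply, Fin.ext_iff]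

theorem exists_linearMap_stdVec (n : ℕ) (y : ℕ → Fin n → D) :
    ∃ f : (Fin n → D) →ₗ[D] (Fin n → D), ∀ i < n, f (stdVec D n i) = y i :=
  ⟨(Pi.basisFun D (Fin n)).constr ℕ fun i => y i, fun i hi => by
    rw [← basisFun_eq_stdVec ⟨i, hi⟩, Module.Basis.constr_basis]⟩

theorem isDiagonalizableEnd_of_stdVec {n : ℕ} {f : (Fin n → D) →ₗ[D] (Fin n → D)}
    (h : ∀ i < n, stdVec D n i ∈ Submodule.span D (eigenvectorSet f)) :
    IsDiagonalizableEnd f := by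
  rw [IsDiagonalizableEnd, eq_top_iff, ← (Pi.basisFun D (Fin n)).span_eq, Submodule.span_le]
  rintro _ ⟨i, rfl⟩
  rw [basisFun_eq_stdVec]
  exact h i i.2

/-- The subspace of vectors whose coordinates of index `< i` vanish. -/
def coordFlag (D : Type*) [DivisionRing D] (n i : ℕ) : Submodule D (Fin n → D) :=
  Submodule.span D {w | ∃ j, i ≤ j ∧ w = stdVec D n j}

theorem stdVec_mem_coordFlag {n i j : ℕ} (h : i ≤ j) : stdVec D n j ∈ coordFlag D n i :=
  Submodule.subset_span ⟨j, h, rfl⟩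

theorem coordFlag_anti {n i j : ℕ} (h : i ≤ j) : coordFlag D n j ≤ coordFlag D n i :=
  Submodule.span_mono fun _ ⟨m, hm, hw⟩ => ⟨m, h.trans hm, hw⟩

theorem coordFlag_eq_bot {n i : ℕ} (h : n ≤ i) : coordFlag D n i = ⊥ := by
  rw [coordFlag, Submodule.span_eq_bot]
  rintro _ ⟨j, hj, rfl⟩
  exact stdVec_eq_zero (h.trans hj)

/-- Strictly triangular endomorphisms with nonzero entries next to the diagonal are regular
nilpotent. -/
theorem pow_of_strictly_triangular {n : ℕ} {f : (Fin (n + 1) → D) →ₗ[D] (Fin (n + 1) → D)}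
    (h : ∀ i < n + 1, ∃ c : D, c ≠ 0 ∧
      f (stdVec D (n + 1) i) - c • stdVec D (n + 1) (i + 1) ∈ coordFlag D (n + 1) (i + 2)) :
    f ^ (n + 1) = 0 ∧ (LinearMap.proj (Fin.last n) : (Fin (n + 1) → D) →ₗ[D] D)
      ((f ^ n) (stdVec D (n + 1) 0)) ≠ 0 := by
  have hstep : ∀ i, ∀ w ∈ coordFlag D (n + 1) i, f w ∈ coordFlag D (n + 1) (i + 1) := by
    intro i
    suffices H : coordFlag D (n + 1) i ≤ (coordFlag D (n + 1) (i + 1)).comap f from H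
    rw [coordFlag, Submodule.span_le]
    rintro _ ⟨j, hj, rfl⟩
    by_cases hjn : j < n + 1
    · obtain ⟨c, -, hc⟩ := h j hjn
      have h1 := coordFlag_anti (D := D) (n := n + 1) (show i + 1 ≤ j + 2 by omega) hc
      have h2 := Submodule.add_mem _ h1 (Submodule.smul_mem _ c
        (stdVec_mem_coordFlag (D := D) (n := n + 1) (show i + 1 ≤ j + 1 by omega)))
      simpa using h2
    · rw [stdVec_eq_zero (by omega)]; exact Submodule.zero_mem _
  have hpow : ∀ m i, ∀ w ∈ coordFlag D (n + 1) i, (f ^ m) w ∈ coordFlag D (n + 1) (i + m) := by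
    intro m
    induction m with
    | zero => intro i w hw; simpa using hw
    | succ m ih =>
      intro i w hw
      rw [pow_succ', Module.End.mul_apply]
      exact hstep _ _ (ih i w hw)
  constructor
  · refine (Pi.basisFun D (Fin (n + 1))).ext fun i => ?_
    have := hpow (n + 1) i _ (stdVec_mem_coordFlag le_rfl)
    rw [coordFlag_eq_bot (by omega)] at this
    rw [basisFun_eq_stdVec]
    simpa using this
  · have key : ∀ m ≤ n, ∃ c : D, c ≠ 0 ∧
        (f ^ m) (stdVec D (n + 1) 0) - c • stdVec D (n + 1) m ∈ coordFlag D (n + 1) (m + 1) := by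
      intro m
      induction m with
      | zero => intro _; exact ⟨1, one_ne_zero, by simp⟩
      | succ m ih =>
        intro hm
        obtain ⟨c, hc0, hc⟩ := ih (by omega)
        obtain ⟨d, hd0, hd⟩ := h m (by omega)
        refine ⟨c * d, mul_ne_zero hc0 hd0, ?_⟩
        have := Submodule.add_mem _ (hstep _ _ hc) (Submodule.smul_mem _ c hd)
        rw [map_sub, map_smul, smul_sub, smul_smul, sub_add_sub_cancel] at this
        rwa [pow_succ', Module.End.mul_apply]
    obtain ⟨c, hc0, hc⟩ := key n le_rfl
    rw [coordFlag_eq_bot le_rfl, Submodule.mem_bot, sub_eq_zero] at hc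
    rw [hc]
    simpa [stdVec] using hc0

theorem isProductOfDiagonalizable_leftShift {a : D} (ha0 : a ≠ 0) (ha1 : a ≠ 1) (n : ℕ) :
    IsProductOfDiagonalizable (leftShift D (n + 1)) := by
  set y := stdVec D (n + 1) with hy
  obtain ⟨C, hC⟩ := exists_linearMap_stdVec (D := D) (n + 1) fun i =>
    if 2 * i < n then (1 + a) • y i + y (n - i) else if 2 * i = n then y i else -(a • y (n - i))
  obtain ⟨B, hB⟩ := exists_linearMap_stdVec (D := D) (n + 1) fun i =>
    if n + 1 < 2 * i then (1 + a) • y i + y (n + 1 - i) else if 2 * i = n + 1 then y i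
      else -(a • y (n + 1 - i))
  rw [← hy] at hC hB
  have hC1 : ∀ i, 2 * i < n → C (y i) = (1 + a) • y i + y (n - i) := fun i hi => by
    rw [hC i (by omega), if_pos hi]
  have hC2 : ∀ i, 2 * i = n → C (y i) = y i := fun i hi => by
    rw [hC i (by omega), if_neg (by omega), if_pos hi]
  have hC3 : ∀ i, n < 2 * i → i < n + 1 → C (y i) = -(a • y (n - i)) := fun i hi hi' => by
    rw [hC i hi', if_neg (by omega), if_neg (by omega)]
  have hB1 : ∀ i, n + 1 < 2 * i → i < n + 1 → B (y i) = (1 + a) • y i + y (n + 1 - i) :=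
    fun i hi hi' => by rw [hB i hi', if_pos hi]
  have hB2 : ∀ i, 2 * i = n + 1 → B (y i) = y i := fun i hi => by
    rw [hB i (by omega), if_neg (by omega), if_pos hi]
  have hB3 : ∀ i, 2 * i < n + 1 → B (y i) = -(a • y (n + 1 - i)) := fun i hi => by
    rw [hB i (by omega), if_neg (by omega), if_neg (by omega)]
  have hCd : IsDiagonalizableEnd C := by
    refine isDiagonalizableEnd_of_stdVec fun i hi => ?_
    rw [← hy]
    rcases lt_trichotomy (2 * i) n with h | h | h
    · refine (mem_span_eigenvectorSet_of_pair ha1 (hC1 i h) ?_).1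
      rw [hC3 _ (by omega) (by omega), Nat.sub_sub_self (by omega)]
    · exact Submodule.subset_span ⟨1, by rw [hC2 i h, one_smul]⟩
    · refine (mem_span_eigenvectorSet_of_pair (y := y (n - i)) ha1 ?_ (hC3 i h hi)).2
      rw [hC1 _ (by omega), Nat.sub_sub_self (by omega)]
  have hBd : IsDiagonalizableEnd B := by
    refine isDiagonalizableEnd_of_stdVec fun i hi => ?_
    rw [← hy]
    rcases lt_trichotomy (2 * i) (n + 1) with h | h | h
    · rcases Nat.eq_zero_or_pos i with rfl | hi0
      · refine Submodule.subset_span ⟨0, ?_⟩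
        rw [hB3 _ h, hy, stdVec_eq_zero (by omega)]; simp
      · refine (mem_span_eigenvectorSet_of_pair (y := y (n + 1 - i)) ha1 ?_ (hB3 i h)).2
        rw [hB1 _ (by omega) (by omega), Nat.sub_sub_self (by omega)]
    · exact Submodule.subset_span ⟨1, by rw [hB2 i h, one_smul]⟩
    · refine (mem_span_eigenvectorSet_of_pair ha1 (hB1 i h hi) ?_).1
      rw [hB3 _ (by omega), Nat.sub_sub_self (by omega)]
  have hmem : ∀ {i j}, i ≤ j → y j ∈ coordFlag D (n + 1) i := fun h => stdVec_mem_coordFlag h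
  have htri : ∀ i < n + 1, ∃ c : D, c ≠ 0 ∧
      (B ∘ₗ C) (y i) - c • y (i + 1) ∈ coordFlag D (n + 1) (i + 2) := by
    intro i hi
    rcases lt_trichotomy (2 * i) n with h | h | h
    · refine ⟨1, one_ne_zero, ?_⟩
      rw [LinearMap.comp_apply, hC1 i h, map_add, map_smul, hB3 i (by omega)]
      have h1 : (1 + a) • -(a • y (n + 1 - i)) ∈ coordFlag D (n + 1) (i + 2) :=
        Submodule.smul_mem _ _ (Submodule.neg_mem _ (Submodule.smul_mem _ _ (hmem (by omega))))
      rw [add_sub_assoc]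
      refine Submodule.add_mem _ h1 ?_
      rcases Nat.lt_or_ge (n + 1) (2 * (n - i)) with h' | h'
      · rw [hB1 _ h' (by omega), show n + 1 - (n - i) = i + 1 by omega, one_smul,
          add_sub_cancel_right]
        exact Submodule.smul_mem _ _ (hmem (by omega))
      · rw [hB2 _ (by omega), show n - i = i + 1 by omega, one_smul, sub_self]
        exact Submodule.zero_mem _
    · refine ⟨-a, neg_ne_zero.2 ha0, ?_⟩
      rw [LinearMap.comp_apply, hC2 i h, hB3 i (by omega), show n + 1 - i = i + 1 by omega]
      simp
    · refine ⟨a * a, mul_ne_zero ha0 ha0, ?_⟩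
      rw [LinearMap.comp_apply, hC3 i h hi, map_neg, map_smul, hB3 _ (by omega),
        show n + 1 - (n - i) = i + 1 by omega]
      simp [smul_smul]
  obtain ⟨h1, h2⟩ := pow_of_strictly_triangular htri
  obtain ⟨p, s, hps, hpf, -⟩ := exists_leftShift_retract h1 h2
  have := IsProductOfDiagonalizable.conj ⟨B, C, hBd, hCd, rfl⟩ hps
    ((LinearMap.comp_eq_id_comm ..).1 hps)
  rwa [← LinearMap.comp_assoc, hpf, LinearMap.comp_assoc, hps, LinearMap.comp_id] at this

theorem IsNilpotent.isProductOfDiagonalizable {a : D} (ha0 : a ≠ 0) (ha1 : a ≠ 1)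
    {V : Type*} [AddCommGroup V] [Module D V] [FiniteDimensional D V] {f : V →ₗ[D] V}
    (hf : IsNilpotent f) : IsProductOfDiagonalizable f := by
  induction hd : Module.finrank D V using Nat.strong_induction_on generalizing V with
  | _ d ih =>
    by_cases hf1 : (1 : V →ₗ[D] V) = 0
    · refine ⟨0, 0, isDiagonalizableEnd_zero, isDiagonalizableEnd_zero, ?_⟩
      rw [← mul_one f, hf1, mul_zero, LinearMap.zero_comp]
    obtain ⟨k, hk0, hk⟩ : ∃ k, f ^ k ≠ 0 ∧ f ^ (k + 1) = 0 := by
      classical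
      have hex : ∃ m, f ^ m = 0 := hf
      obtain ⟨k, hk⟩ := Nat.exists_eq_succ_of_ne_zero (n := Nat.find hex) fun h0 => hf1 <| by
        have := Nat.find_spec hex
        rwa [h0, pow_zero] at this
      exact ⟨k, Nat.find_min hex (by omega),
        by rw [← Nat.succ_eq_add_one, ← hk]; exact Nat.find_spec hex⟩
    obtain ⟨v, hv⟩ : ∃ v, (f ^ k) v ≠ 0 := by
      by_contra! h
      exact hk0 (LinearMap.ext h)
    obtain ⟨φ, hφ⟩ := Module.Projective.exists_dual_ne_zero D hv
    obtain ⟨p, s, hps, hpf, hfs⟩ := exists_leftShift_retract hk hφ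
    have hps' : ∀ x, p (s x) = x := fun x => LinearMap.congr_fun hps x
    have hpf' : ∀ x, p (f x) = leftShift D (k + 1) (p x) := fun x => LinearMap.congr_fun hpf x
    have hfs' : ∀ x, f (s x) = s (leftShift D (k + 1) x) := fun x => LinearMap.congr_fun hfs x
    have hinv : ∀ w ∈ LinearMap.ker p, f w ∈ LinearMap.ker p := fun w hw => by
      rw [LinearMap.mem_ker] at hw ⊢
      rw [hpf', hw, map_zero]
    let q : V →ₗ[D] LinearMap.ker p := (LinearMap.id - s ∘ₗ p).codRestrict _ fun w => by
      simp [hps']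
    have hq : ∀ w, (q w : V) = w - s (p w) := fun w => rfl
    have hlt : Module.finrank D (LinearMap.ker p) < d := by
      rw [← hd]
      refine Submodule.finrank_lt fun htop => ?_
      have h1 := hps' 1
      have h2 : s 1 ∈ LinearMap.ker p := htop ▸ Submodule.mem_top
      rw [LinearMap.mem_ker.1 h2] at h1
      exact zero_ne_one h1
    have hres : IsNilpotent (f.restrict hinv) := by
      refine ⟨k + 1, ?_⟩
      rw [Module.End.pow_restrict]
      ext w
      simp [hk]
    have h := (isProductOfDiagonalizable_leftShift ha0 ha1 k).directSum (ih _ hlt hres rfl)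
      (s := s) (p := p) (ι := (LinearMap.ker p).subtype) (q := q) hps'
      (fun w => Subtype.ext (by simp [hq])) (fun x => Subtype.ext (by simp [hq, hps']))
      (fun w => by simp) (fun w => by simp [hq])
    convert h using 1
    ext w
    simp [hq, hfs']

/-- The matrix of a diagonalizable endomorphism of `Fin n → D` is diagonalizable. -/
theorem IsDiagonalizableEnd.isDiagonalizable {n : ℕ} {f : (Fin n → D) →ₗ[D] (Fin n → D)}
    (hf : IsDiagonalizableEnd f) : IsDiagonalizable (LinearMap.toMatrixRight' f) := by
  have hf' : ⊤ ≤ Submodule.span D (eigenvectorSet f) := hf.ge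
  let b₀ := Module.Basis.ofSpan hf'
  let b : Module.Basis (Fin n) D (Fin n → D) := b₀.reindex (b₀.indexEquiv (Pi.basisFun D (Fin n)))
  have hb : ∀ i, ∃ c : D, f (b i) = c • b i := fun i => by
    refine Module.Basis.ofSpan_subset hf' ?_
    simp [b, b₀]
  choose d hd using hb
  let e : (Fin n → D) ≃ₗ[D] (Fin n → D) := b.equivFun
  have he : ∀ i, e (b i) = Pi.single i 1 := fun i => by
    funext j
    rw [b.equivFun_self, Pi.single_apply]
    simp [eq_comm]
  have he' : ∀ i, e.symm (Pi.single i 1) = b i := fun i => by rw [← he, e.symm_apply_apply]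
  refine ⟨LinearMap.toMatrixRight' e.toLinearMap, LinearMap.toMatrixRight' e.symm.toLinearMap,
    ?_, ?_, d, ?_⟩
  · rw [← LinearMap.toMatrixRight'_comp, e.symm_comp, LinearMap.toMatrixRight'_id]
  · rw [← LinearMap.toMatrixRight'_comp, e.comp_symm, LinearMap.toMatrixRight'_id]
  · rw [← LinearMap.toMatrixRight'_comp, ← LinearMap.toMatrixRight'_comp]
    ext i j
    change e (f (e.symm (Pi.single i 1))) j = _
    rw [he', hd, map_smul, he]
    simp [Matrix.diagonal_apply, Pi.single_apply, eq_comm]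

end DiagonalizableEnd

/-- Over a division ring that is not the field with two elements, every nilpotent
    matrix is a product of two diagonalizable matrices. -/
theorem stmt_14 (D : Type*) [DivisionRing D] (hD : Nat.card D ≠ 2)
    {n : ℕ} (N : Matrix (Fin n) (Fin n) D) (hN : IsNilpotent N) :
    ∃ B C : Matrix (Fin n) (Fin n) D,
      IsDiagonalizable B ∧ IsDiagonalizable C ∧ N = B * C := by
  obtain ⟨a, ha0, ha1⟩ : ∃ a : D, a ≠ 0 ∧ a ≠ 1 := by
    by_contra! h
    refine hD (Nat.card_eq_two_iff.2 ⟨0, 1, zero_ne_one, Set.eq_univ_of_forall fun a => ?_⟩)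
    by_cases ha : a = 0
    · exact Or.inl ha
    · exact Or.inr (h a ha)
  have hf : IsNilpotent (Matrix.toLinearMapRight' N) := by
    obtain ⟨k, hk⟩ := hN
    have hpow : ∀ m : ℕ, Matrix.toLinearMapRight' N ^ m = Matrix.toLinearMapRight' (N ^ m) := by
      intro m
      induction m with
      | zero => simp [Module.End.one_eq_id]
      | succ m ih => rw [pow_succ, ih, pow_succ', Matrix.toLinearMapRight'_mul]; rfl
    exact ⟨k, by rw [hpow, hk, map_zero]⟩
  obtain ⟨B, C, hB, hC, h⟩ := hf.isProductOfDiagonalizable ha0 ha1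
  refine ⟨_, _, hC.isDiagonalizable, hB.isDiagonalizable, ?_⟩
  rw [← LinearMap.toMatrixRight'_comp, ← h]
  exact (LinearEquiv.apply_symm_apply LinearMap.toMatrixRight' N).symm
end

section
/- Let D be a radicable division ring with infinite center and n, k positive integers. Then every n×n matrix over D can be written as a sum of two k-th powers of matrices in Mₙ(D), and also as a product of two k-th powers of matrices in Mₙ(D). -/
namespace Matrix

/-- `x` is a `k`-th power, and none of the scalars in `F` is a spectral value of `x`. -/
def IsPowAvoiding {K R : Type*} [Field K] [Ring R] [Algebra K R]
    (k : ℕ) (F : Set K) (x : R) : Prop :=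
  (∃ b, x = b ^ k) ∧ ∀ f ∈ F, IsUnit (x - algebraMap K R f)

section Algebra

variable {K R S : Type*} [Field K] [Ring R] [Algebra K R] [Ring S] [Algebra K S]
  {k : ℕ} {F G : Set K} {x : R}

theorem IsPowAvoiding.mono (h : IsPowAvoiding k G x) (hFG : F ⊆ G) : IsPowAvoiding k F x :=
  ⟨h.1, fun f hf => h.2 f (hFG hf)⟩

theorem IsPowAvoiding.map (e : R →ₐ[K] S) (h : IsPowAvoiding k F x) :
    IsPowAvoiding k F (e x) := by
  obtain ⟨⟨b, rfl⟩, h⟩ := h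
  refine ⟨⟨e b, map_pow e b k⟩, fun f hf => ?_⟩
  simpa using (h f hf).map e

theorem IsPowAvoiding.conj (u : Rˣ) (h : IsPowAvoiding k F x) :
    IsPowAvoiding k F (u * x * ↑u⁻¹) := by
  obtain ⟨⟨b, rfl⟩, h⟩ := h
  refine ⟨⟨u * b * ↑u⁻¹, (Units.conj_pow u b k).symm⟩, fun f hf => ?_⟩
  have : (u : R) * b ^ k * ↑u⁻¹ - algebraMap K R f
      = u * (b ^ k - algebraMap K R f) * ↑u⁻¹ := by
    rw [mul_sub, sub_mul, ← Algebra.commutes f (u : R), mul_assoc (algebraMap K R f)]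
    simp
  rw [this]
  exact (u.isUnit.mul (h f hf)).mul u⁻¹.isUnit

end Algebra

section Blocks

variable {K D : Type*} [Field K] [DivisionRing D] [Algebra K D]
  {p q : Type*} [Fintype p] [Fintype q] [DecidableEq p] [DecidableEq q]
  {k : ℕ} {F : Set K}

theorem isUnit_fromBlocks_diagonal {P : Matrix p p D} {Q : Matrix q q D}
    (hP : IsUnit P) (hQ : IsUnit Q) : IsUnit (fromBlocks P 0 0 Q) := by
  obtain ⟨P, rfl⟩ := hP
  obtain ⟨Q, rfl⟩ := hQ
  exact ⟨⟨fromBlocks P 0 0 Q, fromBlocks ↑P⁻¹ 0 0 ↑Q⁻¹, by simp [fromBlocks_multiply],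
    by simp [fromBlocks_multiply]⟩, rfl⟩

theorem algebraMap_eq_fromBlocks (f : K) :
    algebraMap K (Matrix (p ⊕ q) (p ⊕ q) D) f
      = fromBlocks (algebraMap K _ f) 0 0 (algebraMap K _ f) := by
  simp [Algebra.algebraMap_eq_smul_one, ← fromBlocks_one, fromBlocks_smul]

theorem IsPowAvoiding.fromBlocks_lower {P : Matrix p p D} {Q : Matrix q q D}
    (hP : IsPowAvoiding k F P) (hQ : IsPowAvoiding k F Q) (X : Matrix q p D) :
    IsPowAvoiding k F (fromBlocks P 0 (X * P - Q * X) Q) := by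
  have h : IsPowAvoiding k F (fromBlocks P 0 0 Q) := by
    obtain ⟨⟨b, hb⟩, hP⟩ := hP
    obtain ⟨⟨c, hc⟩, hQ⟩ := hQ
    refine ⟨⟨fromBlocks b 0 0 c, by rw [fromBlocks_diagonal_pow, hb, hc]⟩, fun f hf => ?_⟩
    rw [algebraMap_eq_fromBlocks, sub_eq_add_neg, fromBlocks_neg, fromBlocks_add]
    simpa [sub_eq_add_neg] using isUnit_fromBlocks_diagonal (hP f hf) (hQ f hf)
  let u : (Matrix (p ⊕ q) (p ⊕ q) D)ˣ :=
    ⟨fromBlocks 1 0 X 1, fromBlocks 1 0 (-X) 1, by simp [fromBlocks_multiply],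
      by simp [fromBlocks_multiply]⟩
  convert h.conj u using 1
  simp [u, fromBlocks_multiply, sub_eq_add_neg]

theorem mul_algebraMap_eq_algebraMap_mul (X : Matrix q p D) (t : K) :
    X * algebraMap K (Matrix p p D) t = algebraMap K (Matrix q q D) t * X := by
  simp [Algebra.algebraMap_eq_smul_one]

theorem IsPowAvoiding.fromBlocks_lower_scalar {t : K} {Q : Matrix q q D}
    (hP : IsPowAvoiding k F (algebraMap K (Matrix p p D) t))
    (hQ : IsPowAvoiding k (insert t F) Q) (y : Matrix q p D) :
    IsPowAvoiding k F (fromBlocks (algebraMap K (Matrix p p D) t) 0 y Q) := by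
  obtain ⟨w, hw⟩ := hQ.2 t (Set.mem_insert _ _)
  convert hP.fromBlocks_lower (hQ.mono (Set.subset_insert _ _)) (-(w⁻¹.val * y)) using 2
  rw [mul_algebraMap_eq_algebraMap_mul, ← Matrix.sub_mul, ← neg_sub Q, ← hw]
  simp [← Matrix.mul_assoc]

theorem IsPowAvoiding.fromBlocks_upper_scalar {t : K} {Q : Matrix q q D}
    (hP : IsPowAvoiding k F (algebraMap K (Matrix p p D) t))
    (hQ : IsPowAvoiding k (insert t F) Q) (x : Matrix p q D) :
    IsPowAvoiding k F (fromBlocks (algebraMap K (Matrix p p D) t) x 0 Q) := by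
  obtain ⟨w, hw⟩ := hQ.2 t (Set.mem_insert _ _)
  have h := (hQ.mono (Set.subset_insert _ _)).fromBlocks_lower hP (x * w⁻¹.val)
  rw [← mul_algebraMap_eq_algebraMap_mul, ← Matrix.mul_sub, ← hw, Matrix.mul_assoc, Units.inv_mul,
    Matrix.mul_one] at h
  simpa using h.map (reindexAlgEquiv K D (Equiv.sumComm q p)).toAlgHom

end Blocks

section Similarity

variable {D : Type*} [DivisionRing D] {ι : Type*} [Fintype ι] [DecidableEq ι]

/-- The elementary matrix `1 + s E_{ij}` as a unit. -/
def elementaryUnit {i j : ι} (h : i ≠ j) (s : D) : (Matrix ι ι D)ˣ where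
  val := 1 + single i j s
  inv := 1 - single i j s
  val_inv := by simp [mul_sub, add_mul, single_mul_single_of_ne _ _ _ _ h.symm]
  inv_val := by simp [mul_add, sub_mul, single_mul_single_of_ne _ _ _ _ h.symm]

theorem exists_conj_apply_eq_one_of_offDiag {A : Matrix ι ι D} {i j : ι} (h : i ≠ j)
    (hA : A i j ≠ 0) : ∃ u : (Matrix ι ι D)ˣ, (u⁻¹.val * A * u.val) i i = 1 := by
  refine ⟨elementaryUnit h.symm ((A i j)⁻¹ * (1 - A i i)), ?_⟩
  change ((1 - single j i _ : Matrix ι ι D) * A * (1 + single j i _ : Matrix ι ι D)) i i = 1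
  simp [sub_mul, mul_add, h, hA, Matrix.mul_assoc]

theorem exists_conj_apply_eq_one {A : Matrix ι ι D} (hA : ∀ a : D, A ≠ diagonal fun _ => a) :
    ∃ (u : (Matrix ι ι D)ˣ) (i : ι), (u⁻¹.val * A * u.val) i i = 1 := by
  by_cases hoff : ∃ i j, i ≠ j ∧ A i j ≠ 0
  · obtain ⟨i, j, hij, h⟩ := hoff
    obtain ⟨u, hu⟩ := exists_conj_apply_eq_one_of_offDiag hij h
    exact ⟨u, i, hu⟩
  · push Not at hoff
    obtain ⟨i, j, hne⟩ : ∃ i j, A i i ≠ A j j := by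
      by_contra! hc
      rcases isEmpty_or_nonempty ι with hι | ⟨⟨i⟩⟩
      · exact hA 0 (Subsingleton.elim _ _)
      · refine hA (A i i) (ext fun a b => ?_)
        rcases eq_or_ne a b with rfl | hab
        · simpa using hc a i
        · simpa [hab] using hoff a b hab
    have hij : i ≠ j := fun h => hne (h ▸ rfl)
    let v := elementaryUnit hij (1 : D)
    have hv : (v⁻¹.val * A * v.val) i j ≠ 0 := by
      change ((1 - single i j 1 : Matrix ι ι D) * A * (1 + single i j 1 : Matrix ι ι D)) i j ≠ 0
      simpa [sub_mul, mul_add, Matrix.mul_assoc, hoff i j hij, hoff j i hij.symm,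
        neg_add_eq_zero, eq_comm] using hne
    obtain ⟨u, hu⟩ := exists_conj_apply_eq_one_of_offDiag hij hv
    exact ⟨v * u, i, by simpa [mul_assoc] using hu⟩

end Similarity

section Decomposition

variable {K D : Type*} [Field K] [DivisionRing D] [Algebra K D]

/-- A non-scalar matrix is similar to one with an entry `1` on the diagonal, which we move to the
first block. -/
theorem exists_algEquiv_fromBlocks {n : ℕ} {A : Matrix (Fin (n + 1)) (Fin (n + 1)) D}
    (hA : ∀ a : D, A ≠ diagonal fun _ => a) :
    ∃ (u : (Matrix (Fin (n + 1)) (Fin (n + 1)) D)ˣ)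
      (e : Matrix (Unit ⊕ Fin n) (Unit ⊕ Fin n) D ≃ₐ[K] Matrix (Fin (n + 1)) (Fin (n + 1)) D)
      (x : Matrix Unit (Fin n) D) (y : Matrix (Fin n) Unit D) (B : Matrix (Fin n) (Fin n) D),
      A = u.val * e (fromBlocks 1 x y B) * u⁻¹.val := by
  obtain ⟨u, i, hi⟩ := exists_conj_apply_eq_one hA
  let σ : Fin (n + 1) ≃ Unit ⊕ Fin n :=
    (finSuccEquiv' i).trans ((Equiv.optionEquivSumPUnit (Fin n)).trans (Equiv.sumComm _ _))
  let e := reindexAlgEquiv K D σ.symm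
  let C := e.symm (u⁻¹.val * A * u.val)
  refine ⟨u, e, C.toBlocks₁₂, C.toBlocks₂₁, C.toBlocks₂₂, ?_⟩
  have hC : C.toBlocks₁₁ = 1 := by
    ext a b
    have hσ : σ.symm (Sum.inl ()) = i := by simp [σ]
    simpa [C, e, toBlocks₁₁, hσ, reindexAlgEquiv] using hi
  rw [← hC, fromBlocks_toBlocks, AlgEquiv.apply_symm_apply]
  simp [mul_assoc]

theorem isPowAvoiding_diagonal {ι : Type*} [Fintype ι] [DecidableEq ι] {k : ℕ} {F : Set K} {a : D}
    (hpow : ∃ b : D, a = b ^ k) (hF : ∀ f ∈ F, a ≠ algebraMap K D f) :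
    IsPowAvoiding k F (diagonal fun _ : ι => a) := by
  have ha : IsPowAvoiding k F a := ⟨hpow, fun f hf => (sub_ne_zero.2 (hF f hf)).isUnit⟩
  obtain ⟨⟨b, rfl⟩, h⟩ := ha
  refine ⟨⟨diagonal fun _ => b, by simp [diagonal_pow, Pi.pow_def]⟩, fun f hf => ?_⟩
  convert (h f hf).map (scalar ι) using 1
  simp [algebraMap_eq_diagonal, Pi.algebraMap_def]

theorem exists_eq_pow (hrad : ∀ a : D, a ≠ 0 → ∀ k : ℕ, 0 < k → ∃ b : D, b ^ k = a)
    {k : ℕ} (hk : 0 < k) (a : D) : ∃ b : D, a = b ^ k := by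
  rcases eq_or_ne a 0 with rfl | ha
  · exact ⟨0, (zero_pow hk.ne').symm⟩
  · exact (hrad a ha k hk).imp fun _ h => h.symm

theorem isPowAvoiding_algebraMap {ι : Type*} [Fintype ι] [DecidableEq ι] {k : ℕ}
    (hpow : ∀ a : D, ∃ b : D, a = b ^ k) {F : Set K} {t : K} (ht : t ∉ F) :
    IsPowAvoiding k F (algebraMap K (Matrix ι ι D) t) := by
  rw [algebraMap_eq_diagonal]
  refine isPowAvoiding_diagonal (hpow _) fun f hf h => ht ?_
  rwa [(algebraMap K D).injective h]

theorem exists_add_isPowAvoiding [Infinite K] {k : ℕ} (hpow : ∀ a : D, ∃ b : D, a = b ^ k)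
    {n : ℕ} (A : Matrix (Fin n) (Fin n) D) {F : Set K} (hF : F.Finite) :
    ∃ L U : Matrix (Fin n) (Fin n) D,
      A = L + U ∧ IsPowAvoiding k F L ∧ IsPowAvoiding k F U := by
  have hinj := (algebraMap K D).injective
  by_cases hA : ∃ a : D, A = diagonal fun _ => a
  · obtain ⟨a, rfl⟩ := hA
    obtain ⟨t, ht⟩ := (hF.union ((hF.image fun f => a - algebraMap K D f).preimage
      hinj.injOn)).exists_notMem
    simp only [Set.mem_union, not_or, Set.mem_preimage, Set.mem_image, not_exists, not_and] at ht
    refine ⟨diagonal fun _ => algebraMap K D t, diagonal fun _ => a - algebraMap K D t,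
      by simp [diagonal_add], isPowAvoiding_diagonal (hpow _) fun f hf h => ht.1 (hinj h ▸ hf),
      isPowAvoiding_diagonal (hpow _) fun f hf h => ht.2 f hf ?_⟩
    rw [← h, sub_sub_cancel]
  · push Not at hA
    cases n with
    | zero => exact (hA 0 (Subsingleton.elim _ _)).elim
    | succ n =>
      obtain ⟨u, e, x, y, B, rfl⟩ := exists_algEquiv_fromBlocks (K := K) hA
      obtain ⟨t, ht⟩ := (hF.union (hF.image fun f => 1 - f)).exists_notMem
      simp only [Set.mem_union, not_or, Set.mem_image, not_exists, not_and] at ht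
      have ht' : 1 - t ∉ F := fun h => ht.2 _ h (sub_sub_cancel _ _)
      obtain ⟨L, U, rfl, hL, hU⟩ :=
        exists_add_isPowAvoiding hpow B ((hF.insert (1 - t)).insert t)
      have hL' := (isPowAvoiding_algebraMap hpow ht.1).fromBlocks_lower_scalar
        (hL.mono (Set.insert_subset_insert (Set.subset_insert _ _))) y
      have hU' := (isPowAvoiding_algebraMap hpow ht').fromBlocks_upper_scalar
        (hU.mono (Set.subset_insert _ _)) x
      refine ⟨_, _, ?_, (hL'.map e.toAlgHom).conj u, (hU'.map e.toAlgHom).conj u⟩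
      simp [← add_mul, ← mul_add, ← map_add, fromBlocks_add]

theorem exists_mul_isPowAvoiding [Infinite K] {k : ℕ} (hpow : ∀ a : D, ∃ b : D, a = b ^ k)
    {n : ℕ} (A : Matrix (Fin n) (Fin n) D) {F : Set K} (hF : F.Finite) (hF0 : 0 ∉ F) :
    ∃ L U : Matrix (Fin n) (Fin n) D,
      A = L * U ∧ IsPowAvoiding k F L ∧ IsPowAvoiding k F U := by
  have hinj := (algebraMap K D).injective
  by_cases hA : ∃ a : D, A = diagonal fun _ => a
  · obtain ⟨a, rfl⟩ := hA
    obtain ⟨t, ht⟩ := ((hF.insert 0).union ((hF.image fun f => a * (algebraMap K D f)⁻¹).preimage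
      hinj.injOn)).exists_notMem
    simp only [Set.mem_union, Set.mem_insert_iff, not_or, Set.mem_preimage, Set.mem_image,
      not_exists, not_and] at ht
    have ht0 : algebraMap K D t ≠ 0 := by simpa using ht.1.1
    refine ⟨diagonal fun _ => algebraMap K D t, diagonal fun _ => (algebraMap K D t)⁻¹ * a,
      by simp [ht0], isPowAvoiding_diagonal (hpow _) fun f hf h => ht.1.2 (hinj h ▸ hf),
      isPowAvoiding_diagonal (hpow _) fun f hf h => ht.2 f hf ?_⟩
    have hf0 : algebraMap K D f ≠ 0 := by
      simpa using fun h : f = 0 => hF0 (h ▸ hf)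
    rw [mul_inv_eq_iff_eq_mul₀ hf0, ← h, mul_inv_cancel_left₀ ht0]
  · push Not at hA
    cases n with
    | zero => exact (hA 0 (Subsingleton.elim _ _)).elim
    | succ n =>
      obtain ⟨u, e, x, y, B, rfl⟩ := exists_algEquiv_fromBlocks (K := K) hA
      obtain ⟨t, ht⟩ := ((hF.insert 0).union (hF.image fun f => f⁻¹)).exists_notMem
      simp only [Set.mem_union, Set.mem_insert_iff, not_or, Set.mem_image, not_exists,
        not_and] at ht
      obtain ⟨⟨ht0, htF⟩, ht⟩ := ht
      have ht' : t⁻¹ ∉ F := fun h => ht _ h (inv_inv _)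
      obtain ⟨L, U, hB, hL, hU⟩ :=
        exists_mul_isPowAvoiding hpow (B - y * x) ((hF.insert t⁻¹).insert t)
          (by simp [ht0, hF0, Ne.symm ht0, eq_comm])
      have hL' := (isPowAvoiding_algebraMap hpow htF).fromBlocks_lower_scalar
        (hL.mono (Set.insert_subset_insert (Set.subset_insert _ _))) (t • y)
      have hU' := (isPowAvoiding_algebraMap hpow ht').fromBlocks_upper_scalar
        (hU.mono (Set.subset_insert _ _)) (t⁻¹ • x)
      refine ⟨_, _, ?_, (hL'.map e.toAlgHom).conj u, (hU'.map e.toAlgHom).conj u⟩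
      have hmul : fromBlocks 1 x y B = fromBlocks (algebraMap K _ t) 0 (t • y) L *
          fromBlocks (algebraMap K _ t⁻¹) (t⁻¹ • x) 0 U := by
        simp [fromBlocks_multiply, ← hB, Algebra.algebraMap_eq_smul_one, smul_smul, ht0]
      rw [hmul]
      simp [mul_assoc]

end Decomposition

end Matrix


/-- Over a radicable division ring with infinite center, every n×n matrix is both
    a sum of two k-th powers and a product of two k-th powers. -/
theorem stmt_16 (D : Type*) [DivisionRing D]
    (hrad : ∀ a : D, a ≠ 0 → ∀ k : ℕ, 0 < k → ∃ b : D, b ^ k = a)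
    (hcenter : Infinite (Subring.center D))
    {n : ℕ} (hn : 0 < n) (k : ℕ) (hk : 0 < k) (A : Matrix (Fin n) (Fin n) D) :
    (∃ B C : Matrix (Fin n) (Fin n) D, A = B ^ k + C ^ k) ∧
    (∃ B C : Matrix (Fin n) (Fin n) D, A = B ^ k * C ^ k) := by
  have hpow := Matrix.exists_eq_pow hrad hk
  constructor
  · obtain ⟨L, U, h, ⟨⟨b, rfl⟩, -⟩, ⟨⟨c, rfl⟩, -⟩⟩ :=
      Matrix.exists_add_isPowAvoiding (K := Subring.center D) hpow A Set.finite_empty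
    exact ⟨b, c, h⟩
  · obtain ⟨L, U, h, ⟨⟨b, rfl⟩, -⟩, ⟨⟨c, rfl⟩, -⟩⟩ :=
      Matrix.exists_mul_isPowAvoiding (K := Subring.center D) hpow A Set.finite_empty
        (Set.notMem_empty _)
    exact ⟨b, c, h⟩
end
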